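/- arXiv:1012.1691 — 4 statements merged into one kernel-verified Lean document; each statement's English description precedes it below -/
import Mathlib

section
/- Let N, E, A ∈ ℝ² be affinely independent, M = conv{N, E, A}, G = (N + E + A)/3 its centroid. Let τ = (N − E)/‖N − E‖ and let n be the unit vector orthogonal to N − E with ⟨n, A − E⟩ > 0. Let φ be a C¹ vector field on a neighborhood of M whose divergence is constant on M and whose normal trace vanishes on the segments [N, A] and [E, A]. Set α = ∫₀^{‖N−E‖} ⟨φ(E + s·τ), n⟩ ds and α₁ = ∫₀^{‖N−E‖} s·⟨φ(E + s·τ), n⟩ ds, and assume the duality relation α₁ = ⟨G − E, τ⟩·α. Then for every constant vector ξ ∈ ℝ²: ⟨ξ, ∫_M φ(x) dx⟩ = ⟨ξ, n⟩·⟨G − E, n⟩·α; equivalently ∫_M φ(x) dx = α·⟨G − E, n⟩·n. (Lemma 2, 'A mean value of the dual Raviart–Thomas basis function', identity (3.15).) -/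
open MeasureTheory
open scoped RealInnerProductSpace

/-- The determinant of two plane vectors. -/
def planeCross (a b : EuclideanSpace ℝ (Fin 2)) : ℝ := a 0 * b 1 - a 1 * b 0

/-- Collapsed (Duffy) coordinates on the triangle with vertices `A`, `A + v`, `A + v + w`. -/
noncomputable def duffy (A v w : EuclideanSpace ℝ (Fin 2)) (z : ℝ × ℝ) :
    EuclideanSpace ℝ (Fin 2) :=
  A + z.1 • (v + z.2 • w)

theorem duffy_image_Icc (N E A : EuclideanSpace ℝ (Fin 2)) :
    duffy A (E - A) (N - E) '' Set.Icc (0 : ℝ × ℝ) 1 = convexHull ℝ {N, E, A} := by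
  have hperm : ({N, E, A} : Set (EuclideanSpace ℝ (Fin 2))) = {A, E, N} := by
    ext x; simp only [Set.mem_insert_iff, Set.mem_singleton_iff]; tauto
  rw [hperm, convexHull_insert (Set.insert_nonempty _ _), convexHull_pair]
  ext x
  simp only [Set.mem_image, mem_convexJoin, Set.mem_singleton_iff, exists_eq_left,
    segment_eq_image', exists_exists_and_eq_and, Set.mem_Icc]
  constructor
  · rintro ⟨⟨u, t⟩, ⟨⟨hu, ht⟩, ⟨hu', ht'⟩⟩, rfl⟩
    refine ⟨t, ⟨ht, ht'⟩, u, ⟨hu, hu'⟩, ?_⟩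
    simp only [duffy]
    module
  · rintro ⟨t, ⟨ht, ht'⟩, u, ⟨hu, hu'⟩, rfl⟩
    refine ⟨(u, t), ⟨⟨hu, ht⟩, ⟨hu', ht'⟩⟩, ?_⟩
    simp only [duffy]
    module

theorem duffy_injOn (A : EuclideanSpace ℝ (Fin 2)) {v w : EuclideanSpace ℝ (Fin 2)}
    (h : planeCross v w ≠ 0) : Set.InjOn (duffy A v w) {z | z.1 ≠ 0} := by
  rintro ⟨u, t⟩ hu ⟨u', t'⟩ - heq
  have h0 := congrArg (fun x : EuclideanSpace ℝ (Fin 2) => x 0) heq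
  have h1 := congrArg (fun x : EuclideanSpace ℝ (Fin 2) => x 1) heq
  simp only [duffy, PiLp.add_apply, PiLp.smul_apply, smul_eq_mul, add_right_inj] at h0 h1
  have hu' : u = u' := by
    apply mul_right_cancel₀ h
    unfold planeCross
    linear_combination w 1 * h0 - w 0 * h1
  subst hu'
  have ht : t = t' := by
    apply mul_left_cancel₀ hu
    apply mul_right_cancel₀ h
    unfold planeCross
    linear_combination v 0 * h1 - v 1 * h0
  rw [ht]

theorem volume_preserving_finTwo_coords :
    MeasurePreserving (fun x : EuclideanSpace ℝ (Fin 2) => (x 0, x 1)) :=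
  (volume_preserving_finTwoArrow ℝ).comp (PiLp.volume_preserving_ofLp (Fin 2))

theorem measurableEmbedding_finTwo_coords :
    MeasurableEmbedding (fun x : EuclideanSpace ℝ (Fin 2) => (x 0, x 1)) :=
  ((MeasurableEquiv.toLp 2 (Fin 2 → ℝ)).symm.trans
    MeasurableEquiv.finTwoArrow).measurableEmbedding

theorem setIntegral_duffy_image (A : EuclideanSpace ℝ (Fin 2)) {v w : EuclideanSpace ℝ (Fin 2)}
    (h : planeCross v w ≠ 0) (g : EuclideanSpace ℝ (Fin 2) → ℝ) :
    ∫ x in duffy A v w '' Set.Icc (0 : ℝ × ℝ) 1, g x =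
      |planeCross v w| * ∫ z in Set.Icc (0 : ℝ × ℝ) 1, z.1 * g (duffy A v w z) := by
  set S : Set (ℝ × ℝ) := Set.Ioc 0 1 ×ˢ Set.Icc 0 1 with hS
  have hSm : MeasurableSet S := measurableSet_Ioc.prod measurableSet_Icc
  have hSI : S =ᵐ[volume] Set.Icc (0 : ℝ × ℝ) 1 := by
    rw [Set.Icc_prod_eq]
    exact Measure.set_prod_ae_eq Ioc_ae_eq_Icc (ae_eq_refl _)
  have himage : duffy A v w '' S =ᵐ[volume] duffy A v w '' Set.Icc (0 : ℝ × ℝ) 1 := by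
    have hsub : S ⊆ Set.Icc (0 : ℝ × ℝ) 1 := by
      rw [Set.Icc_prod_eq]
      exact Set.prod_mono Set.Ioc_subset_Icc_self le_rfl
    refine (Set.image_mono hsub).eventuallyLE.antisymm ?_
    refine (ae_le_set (μ := volume)).2 (measure_mono_null ?_ (measure_singleton A))
    rintro _ ⟨⟨⟨u, t⟩, hz, rfl⟩, hnot⟩
    rw [Set.Icc_prod_eq] at hz
    rcases hz.1.1.eq_or_lt with h0 | h0
    · have h0' : u = 0 := h0.symm
      simp [duffy, h0']
    · exact absurd ⟨_, ⟨⟨h0, hz.1.2⟩, hz.2⟩, rfl⟩ hnot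
  rw [← setIntegral_congr_set himage]
  let Ψ : ℝ × ℝ → ℝ × ℝ := fun z => ((duffy A v w z) 0, (duffy A v w z) 1)
  let Ψ' : ℝ × ℝ → ℝ × ℝ →L[ℝ] ℝ × ℝ := fun z =>
    (Matrix.toLin (.finTwoProd ℝ) (.finTwoProd ℝ)
      !![v 0 + z.2 * w 0, z.1 * w 0; v 1 + z.2 * w 1, z.1 * w 1]).toContinuousLinearMap
  have hΨ : ∀ z, HasFDerivAt Ψ (Ψ' z) z := by
    intro z
    simp only [Ψ', Matrix.toLin_finTwoProd_toContinuousLinearMap]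
    refine HasFDerivAt.prodMk ?_ ?_
    · have := (hasFDerivAt_fst (𝕜 := ℝ) (p := z)).mul
        (((hasFDerivAt_snd (𝕜 := ℝ) (p := z)).mul_const (w 0)).const_add (v 0))
      refine HasFDerivAt.congr_fderiv (this.const_add (A 0)) ?_
      ext <;> simp
    · have := (hasFDerivAt_fst (𝕜 := ℝ) (p := z)).mul
        (((hasFDerivAt_snd (𝕜 := ℝ) (p := z)).mul_const (w 1)).const_add (v 1))
      refine HasFDerivAt.congr_fderiv (this.const_add (A 1)) ?_
      ext <;> simp
  have hinj : Set.InjOn Ψ S := by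
    intro z hz z' hz' heq
    refine duffy_injOn A h (ne_of_gt hz.1.1) (ne_of_gt hz'.1.1) ?_
    exact measurableEmbedding_finTwo_coords.injective heq
  let T : ℝ × ℝ → EuclideanSpace ℝ (Fin 2) := fun z => !₂[z.1, z.2]
  have hT : ∀ x : EuclideanSpace ℝ (Fin 2), T (x 0, x 1) = x := by
    intro x; ext i; fin_cases i <;> rfl
  have hpre : (fun x : EuclideanSpace ℝ (Fin 2) => (x 0, x 1)) ⁻¹' (Ψ '' S) =
      duffy A v w '' S := by
    rw [show Ψ = (fun x : EuclideanSpace ℝ (Fin 2) => (x 0, x 1)) ∘ duffy A v w from rfl,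
      Set.image_comp, Set.preimage_image_eq _ measurableEmbedding_finTwo_coords.injective]
  have hcv := volume_preserving_finTwo_coords.setIntegral_preimage_emb
    measurableEmbedding_finTwo_coords (fun z => g (T z)) (Ψ '' S)
  simp only [hpre, hT] at hcv
  rw [hcv, integral_image_eq_integral_abs_det_fderiv_smul volume hSm
    (fun z _ => (hΨ z).hasFDerivWithinAt) hinj, ← integral_const_mul,
    ← setIntegral_congr_set hSI]
  refine setIntegral_congr_fun hSm fun z hz => ?_
  have hdet : (Ψ' z).det = z.1 * planeCross v w := by
    simp only [Ψ', LinearMap.det_toContinuousLinearMap, LinearMap.det_toLin,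
      Matrix.det_fin_two_of, planeCross]
    ring
  simp only [hdet, abs_mul, abs_of_pos hz.1.1, Ψ, hT, smul_eq_mul]
  ring

theorem trace_euclidean_two (T : EuclideanSpace ℝ (Fin 2) →ₗ[ℝ] EuclideanSpace ℝ (Fin 2)) :
    LinearMap.trace ℝ _ T =
      T (EuclideanSpace.single 0 1) 0 + T (EuclideanSpace.single 1 1) 1 := by
  rw [LinearMap.trace_eq_matrix_trace ℝ (EuclideanSpace.basisFun (Fin 2) ℝ).toBasis,
    Matrix.trace_fin_two]
  simp [LinearMap.toMatrix_apply]

theorem planeCross_trace (T : EuclideanSpace ℝ (Fin 2) →ₗ[ℝ] EuclideanSpace ℝ (Fin 2))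
    (a b : EuclideanSpace ℝ (Fin 2)) :
    planeCross (T a) b + planeCross a (T b) = LinearMap.trace ℝ _ T * planeCross a b := by
  have key : ∀ (x : EuclideanSpace ℝ (Fin 2)) (i : Fin 2), T x i =
      x 0 * T (EuclideanSpace.single 0 1) i + x 1 * T (EuclideanSpace.single 1 1) i := by
    intro x i
    have hx : x = x 0 • EuclideanSpace.single 0 1 + x 1 • EuclideanSpace.single 1 1 := by
      ext j; fin_cases j <;> simp
    conv_lhs => rw [hx]
    simp
  rw [trace_euclidean_two]
  simp only [planeCross, key a, key b]
  ring

theorem hasFDerivAt_duffy (A v w : EuclideanSpace ℝ (Fin 2)) (z : ℝ × ℝ) :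
    HasFDerivAt (duffy A v w)
      ((ContinuousLinearMap.fst ℝ ℝ ℝ).smulRight (v + z.2 • w) +
        (ContinuousLinearMap.snd ℝ ℝ ℝ).smulRight (z.1 • w)) z := by
  have := (hasFDerivAt_fst (𝕜 := ℝ) (p := z)).smul
    (((hasFDerivAt_snd (𝕜 := ℝ) (p := z)).smul_const w).const_add v)
  refine HasFDerivAt.congr_fderiv (this.const_add A) ?_
  ext <;> simp

theorem continuous_duffy (A v w : EuclideanSpace ℝ (Fin 2)) : Continuous (duffy A v w) := by
  unfold duffy; fun_prop

/-- The divergence theorem on a triangle, in collapsed coordinates. -/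
theorem integral_trace_fderiv_duffy (A v w : EuclideanSpace ℝ (Fin 2))
    {U : Set (EuclideanSpace ℝ (Fin 2))} (hU : IsOpen U)
    (hsub : duffy A v w '' Set.Icc (0 : ℝ × ℝ) 1 ⊆ U)
    {F : EuclideanSpace ℝ (Fin 2) → EuclideanSpace ℝ (Fin 2)} (hF : ContDiffOn ℝ 1 F U) :
    (planeCross v w * ∫ z in Set.Icc (0 : ℝ × ℝ) 1, z.1 *
        LinearMap.trace ℝ (EuclideanSpace ℝ (Fin 2))
          (fderiv ℝ F (duffy A v w z)).toLinearMap) =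
      (∫ u in (0 : ℝ)..1, planeCross (v + w) (F (duffy A v w (u, 1)))) -
        (∫ u in (0 : ℝ)..1, planeCross v (F (duffy A v w (u, 0)))) +
        ∫ t in (0 : ℝ)..1, planeCross (F (duffy A v w (1, t))) w := by
  have hmem : ∀ z ∈ Set.Icc (0 : ℝ × ℝ) 1, duffy A v w z ∈ U := fun z hz => hsub ⟨z, hz, rfl⟩
  have hFd : ContinuousOn (fun z => fderiv ℝ F (duffy A v w z)) (Set.Icc (0 : ℝ × ℝ) 1) :=
    (hF.continuousOn_fderiv_of_isOpen hU le_rfl).comp (continuous_duffy A v w).continuousOn hmem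
  have htr : ContinuousOn (fun z : ℝ × ℝ => z.1 * LinearMap.trace ℝ (EuclideanSpace ℝ (Fin 2))
      (fderiv ℝ F (duffy A v w z)).toLinearMap) (Set.Icc 0 1) := by
    simp only [trace_euclidean_two, ContinuousLinearMap.coe_coe]
    refine continuous_fst.continuousOn.mul (ContinuousOn.add ?_ ?_)
    · exact (EuclideanSpace.proj (𝕜 := ℝ) (0 : Fin 2)).continuous.comp_continuousOn
        (hFd.clm_apply continuousOn_const)
    · exact (EuclideanSpace.proj (𝕜 := ℝ) (1 : Fin 2)).continuous.comp_continuousOn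
        (hFd.clm_apply continuousOn_const)
  have hP : ∀ (i : Fin 2), ∀ z ∈ Set.Icc (0 : ℝ × ℝ) 1,
      HasFDerivAt (fun z => F (duffy A v w z) i)
        ((EuclideanSpace.proj (𝕜 := ℝ) i).comp ((fderiv ℝ F (duffy A v w z)).comp
          ((ContinuousLinearMap.fst ℝ ℝ ℝ).smulRight (v + z.2 • w) +
            (ContinuousLinearMap.snd ℝ ℝ ℝ).smulRight (z.1 • w)))) z := by
    intro i z hz
    have hd : HasFDerivAt F (fderiv ℝ F (duffy A v w z)) (duffy A v w z) :=
      ((hF.contDiffAt (hU.mem_nhds (hmem z hz))).differentiableAt one_ne_zero).hasFDerivAt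
    exact (EuclideanSpace.proj (𝕜 := ℝ) i).hasFDerivAt.comp z
      (hd.comp z (hasFDerivAt_duffy A v w z))
  let f : ℝ × ℝ → ℝ := fun z => z.1 * planeCross (F (duffy A v w z)) w
  let g : ℝ × ℝ → ℝ := fun z => planeCross (v + z.2 • w) (F (duffy A v w z))
  have hf := fun z hz => (hasFDerivAt_fst (𝕜 := ℝ) (p := z)).mul
    (((hP 0 z hz).mul_const (w 1)).sub ((hP 1 z hz).mul_const (w 0)))
  have hg := fun z hz =>
    ((((hasFDerivAt_snd (𝕜 := ℝ) (p := z)).mul_const (w 0)).const_add (v 0)).mul (hP 1 z hz)).sub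
    ((((hasFDerivAt_snd (𝕜 := ℝ) (p := z)).mul_const (w 1)).const_add (v 1)).mul (hP 0 z hz))
  have hf' : ∀ z ∈ Set.Icc (0 : ℝ × ℝ) 1, HasFDerivAt f _ z := hf
  have hg' : ∀ z ∈ Set.Icc (0 : ℝ × ℝ) 1, HasFDerivAt g _ z := hg
  have hsum : ∀ z ∈ Set.Icc (0 : ℝ × ℝ) 1, fderiv ℝ f z (1, 0) + fderiv ℝ g z (0, 1) =
      planeCross v w * (z.1 * LinearMap.trace ℝ (EuclideanSpace ℝ (Fin 2))
        (fderiv ℝ F (duffy A v w z)).toLinearMap) := by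
    intro z hz
    have key := planeCross_trace (fderiv ℝ F (duffy A v w z)).toLinearMap (v + z.2 • w) w
    rw [(hf' z hz).fderiv, (hg' z hz).fderiv]
    simp [planeCross] at key ⊢
    linear_combination z.1 * key
  have hIoo : ∀ z ∈ Set.Ioo (0 : ℝ × ℝ).1 (1 : ℝ × ℝ).1 ×ˢ Set.Ioo (0 : ℝ × ℝ).2 (1 : ℝ × ℝ).2,
      z ∈ Set.Icc (0 : ℝ × ℝ) 1 := fun z hz =>
    ⟨⟨hz.1.1.le, hz.2.1.le⟩, ⟨hz.1.2.le, hz.2.2.le⟩⟩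
  have hdivthm := integral_divergence_prod_Icc_of_hasFDerivAt_of_le f g (fderiv ℝ f) (fderiv ℝ g)
    0 1 zero_le_one (fun z hz => (hf' z hz).continuousAt.continuousWithinAt)
    (fun z hz => (hg' z hz).continuousAt.continuousWithinAt)
    (fun z hz => (hf' z (hIoo z hz)).differentiableAt.hasFDerivAt)
    (fun z hz => (hg' z (hIoo z hz)).differentiableAt.hasFDerivAt)
    (((continuousOn_const.mul htr).congr hsum).integrableOn_compact isCompact_Icc)
  rw [setIntegral_congr_fun measurableSet_Icc hsum, integral_const_mul] at hdivthm
  rw [hdivthm]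
  simp [f, g]

theorem setIntegral_unitSquare_moment (a b d : ℝ) :
    ∫ z in Set.Icc (0 : ℝ × ℝ) 1, z.1 * (a + z.1 * (b + z.2 * d)) = a / 2 + b / 3 + d / 6 := by
  have hint : IntegrableOn (fun z : ℝ × ℝ => z.1 * (a + z.1 * (b + z.2 * d)))
      (Set.Icc 0 1 ×ˢ Set.Icc 0 1) (volume.prod volume) := by
    rw [← Measure.volume_eq_prod]
    exact (by fun_prop : Continuous fun z : ℝ × ℝ =>
      z.1 * (a + z.1 * (b + z.2 * d))).continuousOn.integrableOn_compact
      (isCompact_Icc.prod isCompact_Icc)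
  have hinner : ∀ u : ℝ, ∫ t in Set.Icc (0 : ℝ) 1, u * (a + u * (b + t * d)) =
      u * a + u ^ 2 * (b + d / 2) := by
    intro u
    rw [integral_Icc_eq_integral_Ioc, ← intervalIntegral.integral_of_le zero_le_one]
    have : ∀ t : ℝ, u * (a + u * (b + t * d)) = (u * a + u ^ 2 * b) + t * (u ^ 2 * d) := by
      intro t; ring
    simp only [this]
    rw [intervalIntegral.integral_add (Continuous.intervalIntegrable (by fun_prop) _ _)
      (Continuous.intervalIntegrable (by fun_prop) _ _)]
    simp
    ring
  rw [Set.Icc_prod_eq, Measure.volume_eq_prod, Prod.fst_zero, Prod.snd_zero, Prod.fst_one,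
    Prod.snd_one, setIntegral_prod _ hint]
  simp only [hinner]
  rw [integral_Icc_eq_integral_Ioc, ← intervalIntegral.integral_of_le zero_le_one,
    intervalIntegral.integral_add (Continuous.intervalIntegrable (by fun_prop) _ _)
      (Continuous.intervalIntegrable (by fun_prop) _ _)]
  simp
  ring

theorem planeCross_smul_right (r : ℝ) (a b : EuclideanSpace ℝ (Fin 2)) :
    planeCross a (r • b) = r * planeCross a b := by
  simp [planeCross]; ring

theorem planeCross_smul_left (r : ℝ) (a b : EuclideanSpace ℝ (Fin 2)) :
    planeCross (r • a) b = r * planeCross a b := by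
  simp [planeCross]; ring

theorem planeCross_eq_zero_of_normal {v y : EuclideanSpace ℝ (Fin 2)}
    (h : ∀ ν : EuclideanSpace ℝ (Fin 2), ‖ν‖ = 1 → ⟪ν, v⟫ = 0 → ⟪y, ν⟫ = 0) :
    planeCross v y = 0 := by
  by_cases hv : v = 0
  · simp [hv, planeCross]
  let m : EuclideanSpace ℝ (Fin 2) := !₂[-v 1, v 0]
  have hm : ‖m‖ = ‖v‖ := by
    simp [m, EuclideanSpace.norm_eq, Fin.sum_univ_two, add_comm]
  have hm0 : ‖m‖ ≠ 0 := by rw [hm]; exact norm_ne_zero_iff.2 hv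
  have h1 := h (‖m‖⁻¹ • m)
    (by rw [norm_smul, norm_inv, norm_norm, inv_mul_cancel₀ hm0])
    (by simp [m, inner_smul_left, PiLp.inner_apply, Fin.sum_univ_two]; right; ring)
  rw [inner_smul_right, mul_eq_zero, or_iff_right (inv_ne_zero hm0)] at h1
  simp [m, PiLp.inner_apply, Fin.sum_univ_two] at h1
  unfold planeCross
  linear_combination h1

/-- For a unit vector `n` orthogonal to `w`, the cross product with `w` is a multiple of the
component along `n`. -/
theorem planeCross_eq_of_orthogonal {n w : EuclideanSpace ℝ (Fin 2)} (hn : ‖n‖ = 1)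
    (hnw : ⟪n, w⟫ = 0) (y : EuclideanSpace ℝ (Fin 2)) :
    planeCross y w = planeCross n w * ⟪y, n⟫ := by
  have h1 : n 0 ^ 2 + n 1 ^ 2 = 1 := by
    have := EuclideanSpace.real_norm_sq_eq n
    rw [hn, Fin.sum_univ_two] at this
    linarith
  simp only [PiLp.inner_apply, Fin.sum_univ_two, RCLike.inner_apply, conj_trivial] at hnw ⊢
  unfold planeCross
  linear_combination (-(y 0 * w 1 - y 1 * w 0)) * h1 + (y 0 * n 1 - n 0 * y 1) * hnw

theorem abs_planeCross_of_orthogonal {n w : EuclideanSpace ℝ (Fin 2)} (hn : ‖n‖ = 1)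
    (hnw : ⟪n, w⟫ = 0) : |planeCross n w| = ‖w‖ := by
  rw [← sq_eq_sq₀ (abs_nonneg _) (norm_nonneg _), sq_abs]
  have h1 := EuclideanSpace.real_norm_sq_eq n
  rw [hn, Fin.sum_univ_two] at h1
  rw [EuclideanSpace.real_norm_sq_eq w, Fin.sum_univ_two]
  simp only [PiLp.inner_apply, Fin.sum_univ_two, RCLike.inner_apply, conj_trivial] at hnw
  unfold planeCross
  linear_combination (-(w 0 ^ 2 + w 1 ^ 2)) * h1 - (n 0 * w 0 + n 1 * w 1) * hnw

/-- The product rule for the divergence. -/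
theorem trace_fderiv_inner_smul (ξ G : EuclideanSpace ℝ (Fin 2))
    {φ : EuclideanSpace ℝ (Fin 2) → EuclideanSpace ℝ (Fin 2)} {x : EuclideanSpace ℝ (Fin 2)}
    (hφ : DifferentiableAt ℝ φ x) :
    LinearMap.trace ℝ (EuclideanSpace ℝ (Fin 2))
        (fderiv ℝ (fun y => ⟪ξ, y - G⟫ • φ y) x).toLinearMap =
      ⟪ξ, φ x⟫ + ⟪ξ, x - G⟫ *
        LinearMap.trace ℝ (EuclideanSpace ℝ (Fin 2)) (fderiv ℝ φ x).toLinearMap := by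
  have hq : HasFDerivAt (fun y => ⟪ξ, y - G⟫) (innerSL ℝ ξ) x :=
    (innerSL ℝ ξ).hasFDerivAt.comp x ((hasFDerivAt_id x).sub_const G)
  have hprod : HasFDerivAt (fun y => ⟪ξ, y - G⟫ • φ y)
      (⟪ξ, x - G⟫ • fderiv ℝ φ x + (innerSL ℝ ξ).smulRight (φ x)) x := hq.smul hφ.hasFDerivAt
  rw [hprod.fderiv]
  simp [trace_euclidean_two, PiLp.inner_apply, Fin.sum_univ_two]
  ring

/-- The mean value of a field with constant divergence and vanishing normal trace on two sides of
a triangle, in terms of its normal trace on the third side. -/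
theorem inner_setIntegral_triangle (N E A : EuclideanSpace ℝ (Fin 2)) (hNE : N ≠ E)
    (n : EuclideanSpace ℝ (Fin 2))
    (hn1 : ‖n‖ = 1) (hn2 : ⟪n, N - E⟫ = 0) (hn3 : 0 < ⟪n, A - E⟫)
    (φ : EuclideanSpace ℝ (Fin 2) → EuclideanSpace ℝ (Fin 2))
    (U : Set (EuclideanSpace ℝ (Fin 2))) (hU : IsOpen U)
    (hMU : convexHull ℝ {N, E, A} ⊆ U)
    (hφ : ContDiffOn ℝ 1 φ U)
    (c : ℝ)
    (hdiv : ∀ x ∈ convexHull ℝ ({N, E, A} : Set (EuclideanSpace ℝ (Fin 2))),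
      LinearMap.trace ℝ (EuclideanSpace ℝ (Fin 2)) (fderiv ℝ φ x).toLinearMap = c)
    (hNA : ∀ x ∈ segment ℝ N A, planeCross (N - A) (φ x) = 0)
    (hEA : ∀ x ∈ segment ℝ E A, planeCross (E - A) (φ x) = 0)
    (ξ : EuclideanSpace ℝ (Fin 2)) :
    ⟪ξ, ∫ x in convexHull ℝ {N, E, A}, φ x⟫ =
      ‖N - E‖ * ∫ t in (0 : ℝ)..1, ⟪ξ, (1 / 3 : ℝ) • (N + E + A) - (E + t • (N - E))⟫ *
        ⟪φ (E + t • (N - E)), n⟫ := by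
  set G := (1 / 3 : ℝ) • (N + E + A) with hG
  set v := E - A with hv
  set w := N - E with hw
  set κ := planeCross n w with hκ
  have himg : duffy A v w '' Set.Icc (0 : ℝ × ℝ) 1 = convexHull ℝ {N, E, A} :=
    duffy_image_Icc N E A
  have hmem : ∀ z ∈ Set.Icc (0 : ℝ × ℝ) 1, duffy A v w z ∈ convexHull ℝ {N, E, A} :=
    fun z hz => himg ▸ Set.mem_image_of_mem _ hz
  have hcompact : IsCompact (convexHull ℝ {N, E, A}) :=
    himg ▸ isCompact_Icc.image (continuous_duffy A v w)
  have hκabs : |κ| = ‖w‖ := abs_planeCross_of_orthogonal hn1 hn2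
  have hκ0 : κ ≠ 0 := by
    rw [← abs_ne_zero, hκabs]
    exact norm_ne_zero_iff.2 (sub_ne_zero.2 hNE)
  set h := ⟪n, A - E⟫ with hh
  have hD : planeCross v w = -(κ * h) := by
    rw [planeCross_eq_of_orthogonal hn1 hn2, real_inner_comm, hv, ← neg_sub A E, inner_neg_right]
    ring
  have hD0 : planeCross v w ≠ 0 := by
    rw [hD]; exact neg_ne_zero.2 (mul_ne_zero hκ0 hn3.ne')
  have hFsmooth : ContDiffOn ℝ 1 (fun y => ⟪ξ, y - G⟫ • φ y) U :=
    (contDiff_const.inner ℝ (contDiff_id.sub contDiff_const)).contDiffOn.smul hφ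
  have hdt := integral_trace_fderiv_duffy A v w hU (himg ▸ hMU) hFsmooth
  have hz1 : ∀ u ∈ Set.uIcc (0 : ℝ) 1,
      planeCross (v + w) (⟪ξ, duffy A v w (u, 1) - G⟫ • φ (duffy A v w (u, 1))) = 0 := by
    intro u hu
    rw [Set.uIcc_of_le zero_le_one] at hu
    have hvw : v + w = N - A := by rw [hv, hw]; abel
    rw [planeCross_smul_right, hvw, hNA, mul_zero]
    rw [segment_symm, segment_eq_image']
    exact ⟨u, hu, by simp only [duffy, one_smul, hvw]⟩
  have hz0 : ∀ u ∈ Set.uIcc (0 : ℝ) 1,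
      planeCross v (⟪ξ, duffy A v w (u, 0) - G⟫ • φ (duffy A v w (u, 0))) = 0 := by
    intro u hu
    rw [Set.uIcc_of_le zero_le_one] at hu
    rw [planeCross_smul_right, hEA, mul_zero]
    rw [segment_symm, segment_eq_image']
    exact ⟨u, hu, by simp only [duffy, zero_smul, add_zero, hv]⟩
  rw [intervalIntegral.integral_congr hz1, intervalIntegral.integral_congr hz0] at hdt
  have hbd : ∀ t : ℝ, duffy A v w (1, t) = E + t • w := by
    intro t
    simp only [duffy, one_smul, hv]
    abel
  have hintφ : ContinuousOn (fun z : ℝ × ℝ => z.1 * ⟪ξ, φ (duffy A v w z)⟫) (Set.Icc 0 1) :=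
    continuous_fst.continuousOn.mul (continuousOn_const.inner
      ((hφ.continuousOn.mono hMU).comp (continuous_duffy A v w).continuousOn hmem))
  have hq : ∀ z : ℝ × ℝ, z.1 * ⟪ξ, duffy A v w z - G⟫ =
      z.1 * (⟪ξ, A - G⟫ + z.1 * (⟪ξ, v⟫ + z.2 * ⟪ξ, w⟫)) := by
    intro z
    have : duffy A v w z - G = (A - G) + z.1 • (v + z.2 • w) := by
      simp only [duffy]; abel
    simp only [this, inner_add_right, inner_smul_right]
  have hq0 : ∫ z in Set.Icc (0 : ℝ × ℝ) 1, z.1 * ⟪ξ, duffy A v w z - G⟫ = 0 := by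
    simp only [hq]
    rw [setIntegral_unitSquare_moment]
    simp only [hG, hv, hw, inner_sub_right, inner_smul_right, inner_add_right]
    ring
  have hqc : Continuous fun z : ℝ × ℝ => z.1 * ⟪ξ, duffy A v w z - G⟫ := by
    simp only [hq]; fun_prop
  have hlhs : ∫ z in Set.Icc (0 : ℝ × ℝ) 1, z.1 *
      LinearMap.trace ℝ (EuclideanSpace ℝ (Fin 2))
        (fderiv ℝ (fun y => ⟪ξ, y - G⟫ • φ y) (duffy A v w z)).toLinearMap =
      ∫ z in Set.Icc (0 : ℝ × ℝ) 1, z.1 * ⟪ξ, φ (duffy A v w z)⟫ := by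
    have hcongr : ∀ z ∈ Set.Icc (0 : ℝ × ℝ) 1, z.1 *
        LinearMap.trace ℝ (EuclideanSpace ℝ (Fin 2))
          (fderiv ℝ (fun y => ⟪ξ, y - G⟫ • φ y) (duffy A v w z)).toLinearMap =
        z.1 * ⟪ξ, φ (duffy A v w z)⟫ + z.1 * ⟪ξ, duffy A v w z - G⟫ * c := by
      intro z hz
      rw [trace_fderiv_inner_smul ξ G ((hφ.contDiffAt
        (hU.mem_nhds (hMU (hmem z hz)))).differentiableAt one_ne_zero), hdiv _ (hmem z hz)]
      ring
    rw [setIntegral_congr_fun measurableSet_Icc hcongr,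
      integral_add (hintφ.integrableOn_compact isCompact_Icc)
        ((hqc.continuousOn.integrableOn_compact isCompact_Icc).mul_const c),
      integral_mul_const, hq0, zero_mul, add_zero]
  rw [hlhs] at hdt
  simp only [planeCross_smul_left, planeCross_eq_of_orthogonal hn1 hn2 (φ _), ← hκ, hbd,
    intervalIntegral.integral_zero] at hdt
  have hside : ∫ t in (0 : ℝ)..1, ⟪ξ, E + t • w - G⟫ * (κ * ⟪φ (E + t • w), n⟫) =
      -κ * ∫ t in (0 : ℝ)..1, ⟪ξ, G - (E + t • w)⟫ * ⟪φ (E + t • w), n⟫ := by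
    rw [← intervalIntegral.integral_const_mul]
    refine intervalIntegral.integral_congr fun t _ => ?_
    simp only [← neg_sub G, inner_neg_right]
    ring
  rw [hside, hD] at hdt
  rw [← integral_inner ((hφ.continuousOn.mono hMU).integrableOn_compact hcompact), ← himg,
    setIntegral_duffy_image A hD0 (fun x => ⟪ξ, φ x⟫), hD, abs_neg, abs_mul, hκabs,
    abs_of_pos hn3, mul_assoc]
  congr 1
  apply mul_left_cancel₀ hκ0
  linear_combination -hdt

/-- Lemma 2 ("A mean value of the dual Raviart–Thomas basis function"),
identity (3.15): under the duality relation `α₁ = ⟨G − E, τ⟩ α`, for every constant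
vector `ξ` one has `⟨ξ, ∫_M φ⟩ = ⟨ξ, n⟩ ⟨G − E, n⟩ α`; equivalently
`∫_M φ = α ⟨G − E, n⟩ n`. -/
theorem stmt4 (N E A : EuclideanSpace ℝ (Fin 2))
    (hindep : AffineIndependent ℝ ![N, E, A])
    (G : EuclideanSpace ℝ (Fin 2)) (hG : G = (1 / 3 : ℝ) • (N + E + A))
    (τ n : EuclideanSpace ℝ (Fin 2))
    (hτ : τ = (‖N - E‖)⁻¹ • (N - E))
    (hn1 : ‖n‖ = 1) (hn2 : ⟪n, N - E⟫ = 0) (hn3 : 0 < ⟪n, A - E⟫)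
    (φ : EuclideanSpace ℝ (Fin 2) → EuclideanSpace ℝ (Fin 2))
    (U : Set (EuclideanSpace ℝ (Fin 2))) (hU : IsOpen U)
    (hMU : convexHull ℝ {N, E, A} ⊆ U)
    (hφ : ContDiffOn ℝ 1 φ U)
    (c : ℝ)
    (hdiv : ∀ x ∈ convexHull ℝ ({N, E, A} : Set (EuclideanSpace ℝ (Fin 2))),
      LinearMap.trace ℝ (EuclideanSpace ℝ (Fin 2)) (fderiv ℝ φ x).toLinearMap = c)
    (hNA : ∀ x ∈ segment ℝ N A, ∀ ν : EuclideanSpace ℝ (Fin 2),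
      ‖ν‖ = 1 → ⟪ν, A - N⟫ = 0 → ⟪φ x, ν⟫ = 0)
    (hEA : ∀ x ∈ segment ℝ E A, ∀ ν : EuclideanSpace ℝ (Fin 2),
      ‖ν‖ = 1 → ⟪ν, A - E⟫ = 0 → ⟪φ x, ν⟫ = 0)
    (α α₁ : ℝ)
    (hα : α = ∫ s in (0 : ℝ)..‖N - E‖, ⟪φ (E + s • τ), n⟫)
    (hα₁ : α₁ = ∫ s in (0 : ℝ)..‖N - E‖, s * ⟪φ (E + s • τ), n⟫)
    (hdual : α₁ = ⟪G - E, τ⟫ * α) :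
    (∀ ξ : EuclideanSpace ℝ (Fin 2),
        ⟪ξ, ∫ x in convexHull ℝ {N, E, A}, φ x⟫ = ⟪ξ, n⟫ * ⟪G - E, n⟫ * α) ∧
      (∫ x in convexHull ℝ {N, E, A}, φ x) = (α * ⟪G - E, n⟫) • n := by
  have hNE : N ≠ E := fun h => by
    have := hindep.injective (a₁ := 0) (a₂ := 1) (by simpa using h)
    simp at this
  have hL : ‖N - E‖ ≠ 0 := norm_ne_zero_iff.2 (sub_ne_zero.2 hNE)
  have hneg : ∀ x y z : EuclideanSpace ℝ (Fin 2),
      planeCross (x - y) z = -planeCross (y - x) z := by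
    intro x y z; simp [planeCross]; ring
  have hNA' : ∀ x ∈ segment ℝ N A, planeCross (N - A) (φ x) = 0 := fun x hx => by
    rw [hneg, planeCross_eq_zero_of_normal (hNA x hx), neg_zero]
  have hEA' : ∀ x ∈ segment ℝ E A, planeCross (E - A) (φ x) = 0 := fun x hx => by
    rw [hneg, planeCross_eq_zero_of_normal (hEA x hx), neg_zero]
  have hLτ : ‖N - E‖ • τ = N - E := by rw [hτ, smul_inv_smul₀ hL]
  have hτ1 : ‖τ‖ = 1 := by rw [hτ, norm_smul, norm_inv, norm_norm, inv_mul_cancel₀ hL]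
  have hnτ : ⟪n, τ⟫ = 0 := by rw [hτ, inner_smul_right, hn2, mul_zero]
  have hpar : ∀ ξ y : EuclideanSpace ℝ (Fin 2), ⟪ξ, y⟫ = ⟪ξ, n⟫ * ⟪y, n⟫ + ⟪ξ, τ⟫ * ⟪y, τ⟫ := by
    intro ξ y
    have h1 := EuclideanSpace.real_norm_sq_eq n
    have h2 := EuclideanSpace.real_norm_sq_eq τ
    rw [hn1, Fin.sum_univ_two] at h1
    have hy := planeCross_eq_of_orthogonal hn1 hnτ y
    have hξ := planeCross_eq_of_orthogonal hn1 hnτ ξ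
    have hκ := abs_planeCross_of_orthogonal hn1 hnτ
    rw [hτ1, ← sq_eq_sq₀ (abs_nonneg _) zero_le_one, sq_abs] at hκ
    rw [hτ1, Fin.sum_univ_two] at h2
    have hprod : planeCross ξ τ * planeCross y τ = ⟪ξ, n⟫ * ⟪y, n⟫ := by
      rw [hy, hξ]
      linear_combination (⟪ξ, n⟫ * ⟪y, n⟫) * hκ
    rw [← hprod]
    simp only [PiLp.inner_apply, Fin.sum_univ_two, RCLike.inner_apply, conj_trivial, planeCross]
    linear_combination (ξ 0 * y 0 + ξ 1 * y 1) * h2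
  have hcont : ContinuousOn (fun s : ℝ => ⟪φ (E + s • τ), n⟫) (Set.uIcc 0 ‖N - E‖) := by
    refine ContinuousOn.inner ((hφ.continuousOn.mono hMU).comp
      (Continuous.continuousOn (by fun_prop)) ?_) continuousOn_const
    intro s hs
    rw [Set.uIcc_of_le (norm_nonneg _)] at hs
    refine segment_subset_convexHull (x := E) (y := N) (by simp) (by simp) ?_
    rw [segment_eq_image']
    refine ⟨s * ‖N - E‖⁻¹, ⟨by have := hs.1; positivity, ?_⟩, ?_⟩
    · rw [← div_eq_mul_inv]; exact div_le_one_of_le₀ hs.2 (norm_nonneg _)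
    · simp only [hτ, mul_smul]
  have hcont' : ContinuousOn (fun s : ℝ => s * ⟪φ (E + s • τ), n⟫) (Set.uIcc 0 ‖N - E‖) :=
    continuousOn_id.mul hcont
  have hmain : ∀ ξ : EuclideanSpace ℝ (Fin 2),
      ⟪ξ, ∫ x in convexHull ℝ {N, E, A}, φ x⟫ = ⟪ξ, n⟫ * ⟪G - E, n⟫ * α := by
    intro ξ
    rw [inner_setIntegral_triangle N E A hNE n hn1 hn2 hn3 φ U hU hMU hφ c hdiv hNA' hEA' ξ, ← hG]
    have hsub := intervalIntegral.mul_integral_comp_mul_right (a := 0) (b := 1)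
      (f := fun s : ℝ => ⟪ξ, G - (E + s • τ)⟫ * ⟪φ (E + s • τ), n⟫) ‖N - E‖
    simp only [mul_smul, hLτ, zero_mul, one_mul] at hsub
    rw [hsub]
    have hsplit : ∀ s : ℝ, ⟪ξ, G - (E + s • τ)⟫ * ⟪φ (E + s • τ), n⟫ =
        ⟪ξ, G - E⟫ * ⟪φ (E + s • τ), n⟫ - ⟪ξ, τ⟫ * (s * ⟪φ (E + s • τ), n⟫) := by
      intro s
      rw [← sub_sub, inner_sub_right ξ (G - E), inner_smul_right]
      ring
    simp only [hsplit]
    rw [intervalIntegral.integral_sub (hcont.intervalIntegrable.const_mul _)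
      (hcont'.intervalIntegrable.const_mul _),
      intervalIntegral.integral_const_mul, intervalIntegral.integral_const_mul, ← hα, ← hα₁, hdual,
      hpar ξ (G - E)]
    ring
  refine ⟨hmain, ext_inner_left ℝ fun ξ => ?_⟩
  rw [hmain, inner_smul_right]
  ring
end

section
/- Let N, E, A ∈ ℝ² be affinely independent, M = conv{N, E, A} with area |M| and centroid G_M = (N + E + A)/3. Let τ = (N − E)/‖N − E‖ and let n be the unit vector orthogonal to N − E with ⟨n, A − E⟩ > 0. Let S ∈ ℝ² be on the other side of the line EN, i.e. ⟨n, S − E⟩ < 0, and let L = conv{S, E, N} with area |L|. Let φ be a C¹ vector field on a neighborhood of M whose divergence is constant on M and whose normal trace vanishes on the segments [N, A] and [E, A]. Set α = ∫₀^{‖N−E‖} ⟨φ(E + s·τ), n⟩ ds and α₁ = ∫₀^{‖N−E‖} s·⟨φ(E + s·τ), n⟩ ds; assume α₁ = ⟨G_M − E, τ⟩·α and the orthogonality ∫_M ⟨φ(x), x − N⟩ dx = 0. Then (1/(2|M|))·∫_M ⟨A − x, φ(x)⟩ dx = (1/(2|L|))·⟨N − S, n⟩·⟨G_M − E, n⟩·α.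 (Lemma 3, 'A simple relation between two triangles', identity (3.16).) -/
open MeasureTheory
open scoped RealInnerProductSpace

/-- The reference triangle with vertices `(0, 0)`, `(1, 0)` and `(0, 1)`. -/
def refTriangle : Set (ℝ × ℝ) := {z | 0 ≤ z.1 ∧ 0 ≤ z.2 ∧ z.1 + z.2 ≤ 1}

/-- The oriented area of the parallelogram spanned by two plane vectors. -/
def cross (x y : EuclideanSpace ℝ (Fin 2)) : ℝ := x 0 * y 1 - x 1 * y 0

/-- The affine parametrization of the triangle with vertices `A`, `A + p`, `A + q`. -/
def triangleMap (A p q : EuclideanSpace ℝ (Fin 2)) (z : ℝ × ℝ) : EuclideanSpace ℝ (Fin 2) :=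
  A + (z.1 • p + z.2 • q)

lemma isCompact_refTriangle : IsCompact refTriangle := by
  apply Metric.isCompact_of_isClosed_isBounded
  · unfold refTriangle
    simp only [Set.ofPred_and]
    exact (isClosed_le (by fun_prop) (by fun_prop)).inter
      ((isClosed_le (by fun_prop) (by fun_prop)).inter (isClosed_le (by fun_prop) (by fun_prop)))
  · refine (Metric.isBounded_Icc (0 : ℝ × ℝ) 1).subset ?_
    rintro ⟨x, y⟩ ⟨h1, h2, h3⟩
    simp only at h1 h2 h3
    exact ⟨⟨h1, h2⟩, ⟨by simp only [Prod.fst_one]; linarith, by simp only [Prod.snd_one]; linarith⟩⟩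

lemma integral_refTriangle {f : ℝ × ℝ → ℝ} (hf : ContinuousOn f refTriangle) :
    ∫ z in refTriangle, f z = ∫ x in (0 : ℝ)..1, ∫ y in (0 : ℝ)..(1 - x), f (x, y) := by
  have hm : MeasurableSet refTriangle := isCompact_refTriangle.isClosed.measurableSet
  have hintegrable : IntegrableOn f refTriangle := hf.integrableOn_compact isCompact_refTriangle
  rw [← integral_indicator hm, Measure.volume_eq_prod,
    integral_prod _ ((integrable_indicator_iff hm).2 hintegrable),
    intervalIntegral.integral_of_le zero_le_one, ← integral_Icc_eq_integral_Ioc,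
    ← integral_indicator measurableSet_Icc]
  congr 1
  ext x
  by_cases hx : x ∈ Set.Icc (0 : ℝ) 1
  · rw [Set.indicator_of_mem hx, intervalIntegral.integral_of_le (by linarith [hx.2]),
      ← integral_Icc_eq_integral_Ioc, ← integral_indicator measurableSet_Icc]
    congr 1
    ext y
    have hiff : (x, y) ∈ refTriangle ↔ y ∈ Set.Icc 0 (1 - x) := by
      constructor
      · rintro ⟨-, h2, h3⟩
        simp only at h2 h3
        exact ⟨h2, by linarith⟩
      · rintro ⟨h2, h3⟩
        exact ⟨hx.1, h2, by simp only; linarith⟩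
    classical
    simp only [Set.indicator_apply, hiff]
  · rw [Set.indicator_of_notMem hx]
    rw [← integral_zero ℝ ℝ]
    congr 1
    ext y
    rw [Set.indicator_of_notMem]
    rintro ⟨h1, h2, h3⟩
    simp only at h1 h2 h3
    exact hx ⟨h1, by linarith⟩

lemma integral_refTriangle_comp_swap (f : ℝ × ℝ → ℝ) :
    ∫ z in refTriangle, f z.swap = ∫ z in refTriangle, f z := by
  have hpre : Prod.swap ⁻¹' refTriangle = refTriangle := by
    ext ⟨x, y⟩
    simp only [refTriangle, Set.mem_preimage, Set.mem_ofPred_eq, Prod.swap_prod_mk]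
    constructor <;> rintro ⟨h1, h2, h3⟩ <;> exact ⟨h2, h1, by linarith⟩
  have h := (Measure.measurePreserving_swap (μ := (volume : Measure ℝ))
    (ν := (volume : Measure ℝ))).setIntegral_preimage_emb
    MeasurableEquiv.prodComm.measurableEmbedding f refTriangle
  rwa [hpre] at h

lemma integral_refTriangle_snd_deriv {u u' : ℝ × ℝ → ℝ} (hu' : ContinuousOn u' refTriangle)
    (hderiv : ∀ z ∈ refTriangle, HasDerivAt (fun s => u (z.1, s)) (u' z) z.2)
    (h0 : ∀ x ∈ Set.Icc (0 : ℝ) 1, u (x, 0) = 0) :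
    ∫ z in refTriangle, u' z = ∫ x in (0 : ℝ)..1, u (x, 1 - x) := by
  rw [integral_refTriangle hu']
  refine intervalIntegral.integral_congr fun x hx => ?_
  rw [Set.uIcc_of_le zero_le_one] at hx
  have hle : (0 : ℝ) ≤ 1 - x := by linarith [hx.2]
  have hmem : ∀ y ∈ Set.uIcc (0 : ℝ) (1 - x), (x, y) ∈ refTriangle := by
    intro y hy
    rw [Set.uIcc_of_le hle] at hy
    exact ⟨hx.1, hy.1, by simp only; linarith [hy.2]⟩
  rw [intervalIntegral.integral_eq_sub_of_hasDerivAt (f := fun y => u (x, y))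
    (fun y hy => hderiv _ (hmem y hy))
    ((hu'.comp (f := fun y => (x, y)) (by fun_prop) hmem).intervalIntegrable), h0 x hx, sub_zero]

lemma integral_refTriangle_fst_deriv {u u' : ℝ × ℝ → ℝ} (hu' : ContinuousOn u' refTriangle)
    (hderiv : ∀ z ∈ refTriangle, HasDerivAt (fun s => u (s, z.2)) (u' z) z.1)
    (h0 : ∀ y ∈ Set.Icc (0 : ℝ) 1, u (0, y) = 0) :
    ∫ z in refTriangle, u' z = ∫ x in (0 : ℝ)..1, u (x, 1 - x) := by
  have hswap : Set.MapsTo Prod.swap refTriangle refTriangle := by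
    rintro ⟨x, y⟩ ⟨h1, h2, h3⟩
    exact ⟨h2, h1, by simp only [Prod.swap_prod_mk] at *; linarith⟩
  rw [← integral_refTriangle_comp_swap,
    integral_refTriangle_snd_deriv (u := fun z => u z.swap) (u' := fun z => u' z.swap)
      (hu'.comp (by fun_prop) hswap) (fun z hz => hderiv _ (hswap hz)) h0]
  have h := intervalIntegral.integral_comp_sub_left (a := 0) (b := 1)
    (fun x => u (x, 1 - x)) (1 : ℝ)
  simpa using h

lemma setIntegral_image_triangleMap {A p q : EuclideanSpace ℝ (Fin 2)} (hD : cross p q ≠ 0)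
    (f : EuclideanSpace ℝ (Fin 2) → ℝ) :
    ∫ x in triangleMap A p q '' refTriangle, f x =
      |cross p q| * ∫ z in refTriangle, f (triangleMap A p q z) := by
  let e : ℝ × ℝ ≃ᵐ EuclideanSpace ℝ (Fin 2) :=
    (MeasurableEquiv.finTwoArrow (α := ℝ)).symm.trans (MeasurableEquiv.toLp 2 (Fin 2 → ℝ))
  have he : MeasurePreserving e :=
    (volume_preserving_finTwoArrow ℝ).symm.trans
      (EuclideanSpace.volume_preserving_symm_measurableEquiv_toLp (Fin 2)).symm
  have he0 : ∀ z, e z 0 = z.1 := fun z => rfl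
  have he1 : ∀ z, e z 1 = z.2 := fun z => rfl
  let B : ℝ × ℝ →L[ℝ] ℝ × ℝ :=
    (Matrix.toLin (Module.Basis.finTwoProd ℝ) (Module.Basis.finTwoProd ℝ)
      !![p 0, q 0; p 1, q 1]).toContinuousLinearMap
  have hB : ∀ z, B z = (p 0 * z.1 + q 0 * z.2, p 1 * z.1 + q 1 * z.2) := fun z =>
    Matrix.toLin_finTwoProd_apply _ _ _ _ z
  have hdet : B.det = cross p q := by
    simp only [B, LinearMap.det_toContinuousLinearMap, LinearMap.det_toLin, Matrix.det_fin_two_of,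
      cross]
    ring
  let G : ℝ × ℝ → ℝ × ℝ := fun z => (A 0, A 1) + B z
  have heG : ∀ z, e (G z) = triangleMap A p q z := by
    intro z
    ext i
    fin_cases i
    · simp [he0, G, hB, triangleMap]; ring
    · simp [he1, G, hB, triangleMap]; ring
  have hinj : Function.Injective G := by
    rintro ⟨x, y⟩ ⟨x', y'⟩ h
    have h1 := congrArg Prod.fst h
    have h2 := congrArg Prod.snd h
    simp only [G, hB, Prod.fst_add, Prod.snd_add] at h1 h2
    have hx : cross p q * (x - x') = 0 := by
      unfold cross; linear_combination q 1 * h1 - q 0 * h2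
    have hy : cross p q * (y - y') = 0 := by
      unfold cross; linear_combination p 0 * h2 - p 1 * h1
    rw [mul_eq_zero, or_iff_right hD, sub_eq_zero] at hx hy
    rw [hx, hy]
  have himg : triangleMap A p q '' refTriangle = e '' (G '' refTriangle) := by
    rw [Set.image_image]
    simp only [heG]
  rw [himg, he.setIntegral_image_emb e.measurableEmbedding,
    integral_image_eq_integral_abs_det_fderiv_smul (f' := fun _ => B) volume
      isCompact_refTriangle.isClosed.measurableSet
      (fun z _ => (B.hasFDerivAt.const_add _).hasFDerivWithinAt) hinj.injOn]
  simp only [hdet, smul_eq_mul, integral_const_mul]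
  simp only [← heG, G]

lemma image_triangleMap_refTriangle (N E A : EuclideanSpace ℝ (Fin 2)) :
    triangleMap A (N - A) (E - A) '' refTriangle = convexHull ℝ {N, E, A} := by
  apply Set.Subset.antisymm
  · rintro _ ⟨⟨a, b⟩, ⟨h1, h2, h3⟩, rfl⟩
    simp only at h1 h2 h3
    have hsub := subset_convexHull ℝ ({N, E, A} : Set (EuclideanSpace ℝ (Fin 2)))
    have h := (convex_convexHull ℝ ({N, E, A} : Set (EuclideanSpace ℝ (Fin 2)))).sum_mem
      (t := Finset.univ) (w := ![a, b, 1 - a - b]) (z := ![N, E, A])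
      (by intro i _; fin_cases i <;> simp <;> linarith)
      (by simp [Fin.sum_univ_three])
      (by intro i _; apply hsub; fin_cases i <;> simp)
    convert h using 1
    simp only [triangleMap, Fin.sum_univ_three, Matrix.cons_val]
    module
  · apply convexHull_min
    · rintro x (rfl | rfl | rfl)
      · exact ⟨(1, 0), by norm_num [refTriangle], by simp [triangleMap]⟩
      · exact ⟨(0, 1), by norm_num [refTriangle], by simp [triangleMap]⟩
      · exact ⟨(0, 0), by norm_num [refTriangle], by simp [triangleMap]⟩
    · rintro _ ⟨⟨a, b⟩, ⟨h1, h2, h3⟩, rfl⟩ _ ⟨⟨a', b'⟩, ⟨h1', h2', h3'⟩, rfl⟩ s t hs ht hst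
      simp only at h1 h2 h3 h1' h2' h3'
      refine ⟨(s * a + t * a', s * b + t * b'), ⟨by positivity, by positivity, ?_⟩, ?_⟩
      · simp only; nlinarith
      · obtain rfl : t = 1 - s := by linarith
        simp only [triangleMap]
        module

lemma setIntegral_triangle {N E A : EuclideanSpace ℝ (Fin 2)} (hD : cross (N - A) (E - A) ≠ 0)
    (f : EuclideanSpace ℝ (Fin 2) → ℝ) :
    ∫ x in convexHull ℝ {N, E, A}, f x =
      |cross (N - A) (E - A)| * ∫ z in refTriangle, f (triangleMap A (N - A) (E - A) z) := by
  rw [← image_triangleMap_refTriangle, setIntegral_image_triangleMap hD]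

lemma integral_quadratic (a b c r : ℝ) :
    ∫ x in (0 : ℝ)..r, (a + b * x + c * x ^ 2) = a * r + b * r ^ 2 / 2 + c * r ^ 3 / 3 := by
  rw [intervalIntegral.integral_eq_sub_of_hasDerivAt
    (f := fun x => a * x + b * x ^ 2 / 2 + c * x ^ 3 / 3)]
  · ring
  · intro x _
    have h := (((hasDerivAt_id x).const_mul a).add
      (((hasDerivAt_pow 2 x).const_mul b).div_const 2)).add
      (((hasDerivAt_pow 3 x).const_mul c).div_const 3)
    refine HasDerivAt.congr_deriv h ?_
    norm_num
    ring
  · exact Continuous.intervalIntegrable (by fun_prop) _ _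

lemma setIntegral_triangle_inner_sub {N E A : EuclideanSpace ℝ (Fin 2)}
    (hD : cross (N - A) (E - A) ≠ 0) (k : ℝ) (w : EuclideanSpace ℝ (Fin 2)) :
    ∫ x in convexHull ℝ {N, E, A}, (k + ⟪x - E, w⟫) =
      |cross (N - A) (E - A)| / 2 * (k + ⟪(1 / 3 : ℝ) • (N + E + A) - E, w⟫) := by
  have haff : ∀ z : ℝ × ℝ, k + ⟪triangleMap A (N - A) (E - A) z - E, w⟫ =
      (k + ⟪A - E, w⟫) + ⟪N - A, w⟫ * z.1 + ⟪E - A, w⟫ * z.2 := by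
    intro z
    simp only [triangleMap, inner_sub_left, inner_add_left, real_inner_smul_left]
    ring
  rw [setIntegral_triangle hD]
  simp only [haff]
  rw [integral_refTriangle (by fun_prop)]
  have hin : ∀ x : ℝ, ∫ y in (0 : ℝ)..(1 - x),
      (k + ⟪A - E, w⟫ + ⟪N - A, w⟫ * x + ⟪E - A, w⟫ * y) =
      (k + ⟪A - E, w⟫ + ⟪E - A, w⟫ / 2) + (⟪N - A, w⟫ - (k + ⟪A - E, w⟫) - ⟪E - A, w⟫) * x +
        (⟪E - A, w⟫ / 2 - ⟪N - A, w⟫) * x ^ 2 := by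
    intro x
    have h := integral_quadratic (k + ⟪A - E, w⟫ + ⟪N - A, w⟫ * x) ⟪E - A, w⟫ 0 (1 - x)
    simp only [zero_mul, add_zero] at h
    rw [h]
    ring
  simp only [hin]
  rw [integral_quadratic]
  simp only [inner_sub_left, inner_add_left, real_inner_smul_left]
  ring

lemma volume_triangle {N E A : EuclideanSpace ℝ (Fin 2)} (hD : cross (N - A) (E - A) ≠ 0) :
    (volume (convexHull ℝ {N, E, A})).toReal = |cross (N - A) (E - A)| / 2 := by
  have h := setIntegral_triangle_inner_sub hD 1 0
  simpa [Measure.real] using h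

lemma cross_mul_trace (L : EuclideanSpace ℝ (Fin 2) →ₗ[ℝ] EuclideanSpace ℝ (Fin 2))
    (p q : EuclideanSpace ℝ (Fin 2)) :
    cross p q * LinearMap.trace ℝ _ L = cross (L p) q + cross p (L q) := by
  let b := (EuclideanSpace.basisFun (Fin 2) ℝ).toBasis
  have hx : ∀ x : EuclideanSpace ℝ (Fin 2), L x = x 0 • L (b 0) + x 1 • L (b 1) := by
    intro x
    rw [← L.map_smul, ← L.map_smul, ← L.map_add]
    congr 1
    ext i
    fin_cases i <;> simp [b]
  rw [LinearMap.trace_eq_matrix_trace ℝ b, Matrix.trace_fin_two, LinearMap.toMatrix_apply,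
    LinearMap.toMatrix_apply, hx p, hx q]
  simp [cross, b]
  ring

lemma ContinuousOn.cross {X : Type*} [TopologicalSpace X] {s : Set X}
    {f g : X → EuclideanSpace ℝ (Fin 2)} (hf : ContinuousOn f s) (hg : ContinuousOn g s) :
    ContinuousOn (fun x => _root_.cross (f x) (g x)) s := by
  unfold _root_.cross
  fun_prop

lemma setIntegral_triangle_trace {N E A : EuclideanSpace ℝ (Fin 2)}
    (hD : cross (N - A) (E - A) ≠ 0)
    {g : EuclideanSpace ℝ (Fin 2) → EuclideanSpace ℝ (Fin 2)}
    {g' : EuclideanSpace ℝ (Fin 2) → EuclideanSpace ℝ (Fin 2) →L[ℝ] EuclideanSpace ℝ (Fin 2)}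
    (hg : ∀ x ∈ convexHull ℝ {N, E, A}, HasFDerivAt g (g' x) x)
    (hg' : ContinuousOn g' (convexHull ℝ {N, E, A}))
    (hNA : ∀ x ∈ segment ℝ N A, cross (N - A) (g x) = 0)
    (hEA : ∀ x ∈ segment ℝ E A, cross (g x) (E - A) = 0) :
    cross (N - A) (E - A) *
        ∫ x in convexHull ℝ {N, E, A}, LinearMap.trace ℝ _ (g' x).toLinearMap =
      |cross (N - A) (E - A)| * ∫ t in (0 : ℝ)..1, cross (g (E + t • (N - E))) (E - N) := by
  have hmaps : Set.MapsTo (triangleMap A (N - A) (E - A)) refTriangle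
      (convexHull ℝ {N, E, A}) := by
    rw [← image_triangleMap_refTriangle]
    exact Set.mapsTo_image _ _
  have hF : Continuous (triangleMap A (N - A) (E - A)) := by
    unfold triangleMap; fun_prop
  have hcont : ∀ v, ContinuousOn (fun z => g' (triangleMap A (N - A) (E - A) z) v) refTriangle :=
    fun v => (hg'.comp hF.continuousOn hmaps).clm_apply continuousOn_const
  have hcoord : ∀ (i : Fin 2) {h : ℝ → EuclideanSpace ℝ (Fin 2)} {h' s}, HasDerivAt h h' s →
      HasDerivAt (fun t => h t i) (h' i) s := fun i h h' s hh =>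
    (EuclideanSpace.proj i : EuclideanSpace ℝ (Fin 2) →L[ℝ] ℝ).hasFDerivAt.comp_hasDerivAt s hh
  have hc1 : ContinuousOn
      (fun z => cross (g' (triangleMap A (N - A) (E - A) z) (N - A)) (E - A)) refTriangle :=
    (hcont (N - A)).cross continuousOn_const
  have hc2 : ContinuousOn
      (fun z => cross (N - A) (g' (triangleMap A (N - A) (E - A) z) (E - A))) refTriangle :=
    continuousOn_const.cross (hcont (E - A))
  have h1 := integral_refTriangle_fst_deriv
    (u := fun z => cross (g (triangleMap A (N - A) (E - A) z)) (E - A)) hc1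
    (by
      intro z hz
      have hd : HasDerivAt (fun s => triangleMap A (N - A) (E - A) (s, z.2)) (N - A) z.1 := by
        simpa [triangleMap] using
          ((((hasDerivAt_id z.1).smul_const (N - A)).add_const (z.2 • (E - A))).const_add A)
      have hgd := (hg _ (hmaps hz)).comp_hasDerivAt z.1 hd
      exact ((hcoord 0 hgd).mul_const _).sub ((hcoord 1 hgd).mul_const _))
    (by
      intro y hy
      refine hEA _ ⟨y, 1 - y, hy.1, by linarith [hy.2], by ring, ?_⟩
      simp only [triangleMap]
      module)
  have h2 := integral_refTriangle_snd_deriv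
    (u := fun z => cross (N - A) (g (triangleMap A (N - A) (E - A) z))) hc2
    (by
      intro z hz
      have hd : HasDerivAt (fun s => triangleMap A (N - A) (E - A) (z.1, s)) (E - A) z.2 := by
        simpa [triangleMap] using
          ((((hasDerivAt_id z.2).smul_const (E - A)).const_add (z.1 • (N - A))).const_add A)
      have hgd := (hg _ (hmaps hz)).comp_hasDerivAt z.2 hd
      exact ((hcoord 1 hgd).const_mul _).sub ((hcoord 0 hgd).const_mul _))
    (by
      intro x hx
      refine hNA _ ⟨x, 1 - x, hx.1, by linarith [hx.2], by ring, ?_⟩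
      simp only [triangleMap]
      module)
  have hpt : ∀ t : ℝ, triangleMap A (N - A) (E - A) (t, 1 - t) = E + t • (N - E) := by
    intro t
    simp only [triangleMap]
    module
  have hedge : ContinuousOn (fun t : ℝ => g (E + t • (N - E))) (Set.uIcc 0 1) := by
    simp only [← hpt]
    rw [Set.uIcc_of_le zero_le_one]
    have hgc : ContinuousOn g (convexHull ℝ {N, E, A}) :=
      fun x hx => (hg x hx).continuousAt.continuousWithinAt
    refine hgc.comp (hF.comp (by fun_prop)).continuousOn fun t ht => hmaps ?_
    exact ⟨ht.1, by simp only; linarith [ht.2], by simp only; linarith⟩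
  have hi1 : IntervalIntegrable (fun t : ℝ => cross (g (E + t • (N - E))) (E - A)) volume 0 1 := by
    refine ContinuousOn.intervalIntegrable ?_
    exact hedge.cross continuousOn_const
  have hi2 : IntervalIntegrable (fun t : ℝ => cross (N - A) (g (E + t • (N - E)))) volume 0 1 := by
    refine ContinuousOn.intervalIntegrable ?_
    exact continuousOn_const.cross hedge
  simp only [hpt] at h1 h2
  have hsum : ∀ v, cross v (E - N) = cross v (E - A) + cross (N - A) v := by
    intro v
    simp only [cross, PiLp.sub_apply]
    ring
  simp only [hsum]
  rw [setIntegral_triangle hD, mul_left_comm, ← integral_const_mul,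
    intervalIntegral.integral_add hi1 hi2, ← h1, ← h2,
    ← integral_add (hc1.integrableOn_compact isCompact_refTriangle)
      (hc2.integrableOn_compact isCompact_refTriangle)]
  simp only [cross_mul_trace, ContinuousLinearMap.coe_coe]

lemma exists_cross_eq {n v : EuclideanSpace ℝ (Fin 2)} (hn : ‖n‖ = 1) (hv : ⟪n, v⟫ = 0) :
    ∃ r : ℝ, |r| = ‖v‖ ∧ ∀ x, cross v x = -(r * ⟪n, x⟫) := by
  have hn2 : n 0 ^ 2 + n 1 ^ 2 = 1 := by
    have := EuclideanSpace.real_norm_sq_eq n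
    rw [hn, Fin.sum_univ_two] at this
    linarith
  have hinner : ∀ x y : EuclideanSpace ℝ (Fin 2), ⟪x, y⟫ = x 0 * y 0 + x 1 * y 1 := by
    intro x y
    simp [PiLp.inner_apply, Fin.sum_univ_two, mul_comm]
  rw [hinner] at hv
  have h0 : v 0 = -(-(v 0 * n 1) + v 1 * n 0) * n 1 := by
    linear_combination n 0 * hv - v 0 * hn2
  have h1 : v 1 = (-(v 0 * n 1) + v 1 * n 0) * n 0 := by
    linear_combination n 1 * hv - v 1 * hn2
  refine ⟨-(v 0 * n 1) + v 1 * n 0, ?_, ?_⟩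
  · rw [← abs_norm, ← sq_eq_sq_iff_abs_eq_abs, EuclideanSpace.real_norm_sq_eq, Fin.sum_univ_two]
    linear_combination (v 0 ^ 2 + v 1 ^ 2) * hn2 - (v 0 * n 0 + v 1 * n 1) * hv
  · intro x
    rw [hinner, cross]
    linear_combination x 1 * h0 - x 0 * h1

lemma inner_eq_add_of_orthonormal {τ n : EuclideanSpace ℝ (Fin 2)} (hτ : ‖τ‖ = 1) (hn : ‖n‖ = 1)
    (hτn : ⟪n, τ⟫ = 0) (x y : EuclideanSpace ℝ (Fin 2)) :
    ⟪x, y⟫ = ⟪x, τ⟫ * ⟪y, τ⟫ + ⟪x, n⟫ * ⟪y, n⟫ := by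
  obtain ⟨r, hr, hcr⟩ := exists_cross_eq hn hτn
  have hr2 : r ^ 2 = 1 := by rw [← sq_abs, hr, hτ, one_pow]
  have hlagrange : cross τ x * cross τ y = ⟪τ, τ⟫ * ⟪x, y⟫ - ⟪x, τ⟫ * ⟪y, τ⟫ := by
    simp only [cross, PiLp.inner_apply, Fin.sum_univ_two, RCLike.inner_apply, conj_trivial]
    ring
  rw [hcr, hcr, real_inner_self_eq_norm_sq, hτ] at hlagrange
  rw [real_inner_comm n x, real_inner_comm n y]
  linear_combination ⟪n, x⟫ * ⟪n, y⟫ * hr2 - hlagrange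

lemma cross_eq_zero_of_normal {p v : EuclideanSpace ℝ (Fin 2)}
    (h : ∀ ν : EuclideanSpace ℝ (Fin 2), ‖ν‖ = 1 → ⟪ν, p⟫ = 0 → ⟪v, ν⟫ = 0) : cross p v = 0 := by
  rcases eq_or_ne p 0 with rfl | hp
  · simp [cross]
  let m : EuclideanSpace ℝ (Fin 2) := !₂[-p 1, p 0]
  have hm : m ≠ 0 := by
    intro h0
    apply hp
    have e0 := congrArg (fun x : EuclideanSpace ℝ (Fin 2) => x 0) h0
    have e1 := congrArg (fun x : EuclideanSpace ℝ (Fin 2) => x 1) h0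
    simp [m] at e0 e1
    ext i
    fin_cases i <;> simp [e0, e1]
  have hmp : ⟪m, p⟫ = 0 := by
    simp [m, PiLp.inner_apply, Fin.sum_univ_two]
    ring
  have h1 := h (‖m‖⁻¹ • m) (by rw [norm_smul, norm_inv, norm_norm,
    inv_mul_cancel₀ (norm_ne_zero_iff.2 hm)]) (by rw [real_inner_smul_left, hmp, mul_zero])
  rw [real_inner_smul_right, mul_eq_zero, or_iff_right (by simpa using hm)] at h1
  rw [← h1]
  simp [m, cross, PiLp.inner_apply, Fin.sum_univ_two]
  ring

lemma cross_neg_swap (x y : EuclideanSpace ℝ (Fin 2)) : cross x y = -cross y x := by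
  unfold cross; ring

lemma setIntegral_triangle_inner_add {N E A n : EuclideanSpace ℝ (Fin 2)} (hNE : N ≠ E)
    (hn1 : ‖n‖ = 1) (hn2 : ⟪n, N - E⟫ = 0) (hn3 : 0 < ⟪n, A - E⟫)
    {φ : EuclideanSpace ℝ (Fin 2) → EuclideanSpace ℝ (Fin 2)}
    {φ' : EuclideanSpace ℝ (Fin 2) → EuclideanSpace ℝ (Fin 2) →L[ℝ] EuclideanSpace ℝ (Fin 2)}
    (hφ : ∀ x ∈ convexHull ℝ {N, E, A}, HasFDerivAt φ (φ' x) x)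
    (hφ' : ContinuousOn φ' (convexHull ℝ {N, E, A}))
    (hNA : ∀ x ∈ segment ℝ N A, cross (N - A) (φ x) = 0)
    (hEA : ∀ x ∈ segment ℝ E A, cross (φ x) (E - A) = 0)
    (k : ℝ) (w : EuclideanSpace ℝ (Fin 2)) :
    ∫ x in convexHull ℝ {N, E, A},
        ((k + ⟪x - E, w⟫) * LinearMap.trace ℝ _ (φ' x).toLinearMap + ⟪φ x, w⟫) =
      -(‖N - E‖ * ∫ t in (0 : ℝ)..1, (k + t * ⟪N - E, w⟫) * ⟪φ (E + t • (N - E)), n⟫) := by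
  obtain ⟨r, hr, hcr⟩ := exists_cross_eq hn1 hn2
  have hr0 : r ≠ 0 := by
    rw [← abs_ne_zero, hr, norm_ne_zero_iff, sub_ne_zero]
    exact hNE
  have hDr : cross (N - A) (E - A) = r * ⟪n, A - E⟫ := by
    have h : cross (N - A) (E - A) = -cross (N - E) (A - E) := by
      simp only [cross, PiLp.sub_apply]; ring
    rw [h, hcr, neg_neg]
  have hD : cross (N - A) (E - A) ≠ 0 := by
    rw [hDr]; exact mul_ne_zero hr0 hn3.ne'
  let P : EuclideanSpace ℝ (Fin 2) → ℝ := fun x => k + innerSL ℝ w (x - E)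
  have hP : ∀ x, P x = k + ⟪x - E, w⟫ := fun x => by
    simp only [P, innerSL_apply_apply, real_inner_comm]
  have hP' : ∀ x, HasFDerivAt P (innerSL ℝ w) x := fun x =>
    HasFDerivAt.congr_of_eventuallyEq
      (((innerSL ℝ w).hasFDerivAt.sub_const (innerSL ℝ w E)).const_add k)
      (Filter.Eventually.of_forall fun y => by simp only [P, map_sub])
  have hφc : ContinuousOn φ (convexHull ℝ {N, E, A}) :=
    fun x hx => (hφ x hx).continuousAt.continuousWithinAt
  have key := setIntegral_triangle_trace hD (g := fun x => P x • φ x)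
    (g' := fun x => P x • φ' x + (innerSL ℝ w).smulRight (φ x))
    (fun x hx => (hP' x).smul (hφ x hx))
    (by
      have hPc : Continuous P := by fun_prop
      refine ContinuousOn.add (hPc.continuousOn.smul hφ') ?_
      exact (ContinuousLinearMap.smulRightL ℝ _ _ (innerSL ℝ w)).continuous.comp_continuousOn hφc)
    (by
      intro x hx
      have h : cross (N - A) (P x • φ x) = P x * cross (N - A) (φ x) := by
        simp only [cross, PiLp.smul_apply, smul_eq_mul]; ring
      rw [h, hNA x hx, mul_zero])
    (by
      intro x hx
      have h : cross (P x • φ x) (E - A) = P x * cross (φ x) (E - A) := by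
        simp only [cross, PiLp.smul_apply, smul_eq_mul]; ring
      rw [h, hEA x hx, mul_zero])
  have htr : ∀ x, LinearMap.trace ℝ _
      (P x • φ' x + (innerSL ℝ w).smulRight (φ x)).toLinearMap =
      (k + ⟪x - E, w⟫) * LinearMap.trace ℝ _ (φ' x).toLinearMap + ⟪φ x, w⟫ := by
    intro x
    have h : (P x • φ' x + (innerSL ℝ w).smulRight (φ x)).toLinearMap =
      P x • (φ' x).toLinearMap + (innerSL ℝ w).toLinearMap.smulRight (φ x) := rfl
    rw [h, map_add, map_smul, LinearMap.trace_smulRight, hP, smul_eq_mul]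
    simp [real_inner_comm]
  have hedge : ∀ t : ℝ, cross (P (E + t • (N - E)) • φ (E + t • (N - E))) (E - N) =
      -r * ((k + t * ⟪N - E, w⟫) * ⟪φ (E + t • (N - E)), n⟫) := by
    intro t
    have h : ∀ (a : ℝ) y, cross (a • y) (E - N) = a * cross (N - E) y := by
      intro a y
      simp only [cross, PiLp.smul_apply, PiLp.sub_apply, smul_eq_mul]; ring
    rw [h, hcr, hP, add_sub_cancel_left, real_inner_smul_left, real_inner_comm n]
    ring
  simp only [htr, hedge, intervalIntegral.integral_const_mul] at key
  rw [hDr, abs_mul, hr, abs_of_pos hn3] at key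
  refine mul_left_cancel₀ (mul_ne_zero hr0 hn3.ne') (key.trans ?_)
  ring

/-- Lemma 3 ("A simple relation between two triangles"), identity (3.16):
`(1/(2|M|)) ∫_M ⟨A − x, φ(x)⟩ dx = (1/(2|L|)) ⟨N − S, n⟩ ⟨G_M − E, n⟩ α`. -/
theorem stmt5 (N E A : EuclideanSpace ℝ (Fin 2))
    (hindep : AffineIndependent ℝ ![N, E, A])
    (GM : EuclideanSpace ℝ (Fin 2)) (hGM : GM = (1 / 3 : ℝ) • (N + E + A))
    (τ n : EuclideanSpace ℝ (Fin 2))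
    (hτ : τ = (‖N - E‖)⁻¹ • (N - E))
    (hn1 : ‖n‖ = 1) (hn2 : ⟪n, N - E⟫ = 0) (hn3 : 0 < ⟪n, A - E⟫)
    (S : EuclideanSpace ℝ (Fin 2)) (hS : ⟪n, S - E⟫ < 0)
    (φ : EuclideanSpace ℝ (Fin 2) → EuclideanSpace ℝ (Fin 2))
    (U : Set (EuclideanSpace ℝ (Fin 2))) (hU : IsOpen U)
    (hMU : convexHull ℝ {N, E, A} ⊆ U)
    (hφ : ContDiffOn ℝ 1 φ U)
    (c : ℝ)
    (hdiv : ∀ x ∈ convexHull ℝ ({N, E, A} : Set (EuclideanSpace ℝ (Fin 2))),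
      LinearMap.trace ℝ (EuclideanSpace ℝ (Fin 2)) (fderiv ℝ φ x).toLinearMap = c)
    (hNA : ∀ x ∈ segment ℝ N A, ∀ ν : EuclideanSpace ℝ (Fin 2),
      ‖ν‖ = 1 → ⟪ν, A - N⟫ = 0 → ⟪φ x, ν⟫ = 0)
    (hEA : ∀ x ∈ segment ℝ E A, ∀ ν : EuclideanSpace ℝ (Fin 2),
      ‖ν‖ = 1 → ⟪ν, A - E⟫ = 0 → ⟪φ x, ν⟫ = 0)
    (α α₁ : ℝ)
    (hα : α = ∫ s in (0 : ℝ)..‖N - E‖, ⟪φ (E + s • τ), n⟫)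
    (hα₁ : α₁ = ∫ s in (0 : ℝ)..‖N - E‖, s * ⟪φ (E + s • τ), n⟫)
    (hdual : α₁ = ⟪GM - E, τ⟫ * α)
    (horth : (∫ x in convexHull ℝ ({N, E, A} : Set (EuclideanSpace ℝ (Fin 2))),
      ⟪φ x, x - N⟫) = 0) :
    (1 / (2 * (volume (convexHull ℝ ({N, E, A} : Set (EuclideanSpace ℝ (Fin 2))))).toReal)) *
        ∫ x in convexHull ℝ ({N, E, A} : Set (EuclideanSpace ℝ (Fin 2))), ⟪A - x, φ x⟫ =
      (1 / (2 * (volume (convexHull ℝ ({S, E, N} : Set (EuclideanSpace ℝ (Fin 2))))).toReal)) *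
        (⟪N - S, n⟫ * (⟪GM - E, n⟫ * α)) := by

  have hNE : N ≠ E := by
    have h := hindep.injective.ne (show (0 : Fin 3) ≠ 1 by decide)
    simpa using h
  have hl : ‖N - E‖ ≠ 0 := norm_ne_zero_iff.2 (sub_ne_zero.2 hNE)
  have hd : ∀ x ∈ convexHull ℝ {N, E, A}, HasFDerivAt φ (fderiv ℝ φ x) x := fun x hx =>
    ((hφ.differentiableOn one_ne_zero).differentiableAt (hU.mem_nhds (hMU hx))).hasFDerivAt
  have hdc : ContinuousOn (fderiv ℝ φ) (convexHull ℝ {N, E, A}) :=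
    (hφ.continuousOn_fderiv_of_isOpen hU le_rfl).mono hMU
  have hφc : ContinuousOn φ (convexHull ℝ {N, E, A}) := hφ.continuousOn.mono hMU
  have hcpt : IsCompact (convexHull ℝ ({N, E, A} : Set (EuclideanSpace ℝ (Fin 2)))) :=
    (Set.toFinite _).isCompact_convexHull ℝ
  have hNA' : ∀ x ∈ segment ℝ N A, cross (N - A) (φ x) = 0 := by
    intro x hx
    refine cross_eq_zero_of_normal fun ν h1 h2 => hNA x hx ν h1 ?_
    rw [← neg_sub, inner_neg_right, h2, neg_zero]
  have hEA' : ∀ x ∈ segment ℝ E A, cross (φ x) (E - A) = 0 := by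
    intro x hx
    rw [cross_neg_swap, neg_eq_zero]
    refine cross_eq_zero_of_normal fun ν h1 h2 => hEA x hx ν h1 ?_
    rw [← neg_sub, inner_neg_right, h2, neg_zero]
  obtain ⟨r, hr, hcr⟩ := exists_cross_eq hn1 hn2
  have hr0 : r ≠ 0 := by rwa [← abs_ne_zero, hr]
  have hDM : cross (N - A) (E - A) = r * ⟪n, A - E⟫ := by
    have h : cross (N - A) (E - A) = -cross (N - E) (A - E) := by
      simp only [cross, PiLp.sub_apply]; ring
    rw [h, hcr, neg_neg]
  have hDL : cross (S - N) (E - N) = -(r * ⟪n, S - E⟫) := by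
    have h : cross (S - N) (E - N) = cross (N - E) (S - E) := by
      simp only [cross, PiLp.sub_apply]; ring
    rw [h, hcr]
  have hDM0 : cross (N - A) (E - A) ≠ 0 := by rw [hDM]; exact mul_ne_zero hr0 hn3.ne'
  have hDL0 : cross (S - N) (E - N) ≠ 0 := by rw [hDL]; exact neg_ne_zero.2 <| mul_ne_zero hr0 hS.ne
  have hintegrable : ∀ w, IntegrableOn (fun x => ⟪φ x, w⟫) (convexHull ℝ {N, E, A}) := fun w =>
    (hφc.inner continuousOn_const).integrableOn_compact hcpt
  have hscale : ∀ f : ℝ → ℝ,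
      ∫ s in (0 : ℝ)..‖N - E‖, f s = ‖N - E‖ * ∫ t in (0 : ℝ)..1, f (‖N - E‖ * t) := by
    intro f
    simp
  have hℓτ : ‖N - E‖ • τ = N - E := by rw [hτ, smul_inv_smul₀ hl]
  have hedge : ∀ t : ℝ, E + (‖N - E‖ * t) • τ = E + t • (N - E) := by
    intro t
    rw [mul_comm, mul_smul, hℓτ]
  have hτ1 : ‖τ‖ = 1 := by rw [hτ, norm_smul, norm_inv, norm_norm, inv_mul_cancel₀ hl]
  have hnτ : ⟪n, τ⟫ = 0 := by rw [hτ, real_inner_smul_right, hn2, mul_zero]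
  have hflux : α = ‖N - E‖ * ∫ t in (0 : ℝ)..1, ⟪φ (E + t • (N - E)), n⟫ := by
    rw [hα, hscale]
    simp only [hedge]
  have hmoment : α₁ = ‖N - E‖ * (‖N - E‖ * ∫ t in (0 : ℝ)..1, t * ⟪φ (E + t • (N - E)), n⟫) := by
    rw [hα₁, hscale]
    simp only [hedge, mul_assoc, intervalIntegral.integral_const_mul]
  have htest : ∀ (k : ℝ) (w : EuclideanSpace ℝ (Fin 2)),
      |cross (N - A) (E - A)| / 2 * (k + ⟪GM - E, w⟫) * c + ∫ x in convexHull ℝ {N, E, A}, ⟪φ x, w⟫ =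
        -(‖N - E‖ * ∫ t in (0 : ℝ)..1, (k + t * ⟪N - E, w⟫) * ⟪φ (E + t • (N - E)), n⟫) := by
    intro k w
    rw [← setIntegral_triangle_inner_add hNE hn1 hn2 hn3 hd hdc hNA' hEA', hGM,
      ← setIntegral_triangle_inner_sub hDM0, ← integral_mul_const, ← integral_add
        (Continuous.continuousOn (by fun_prop) |>.integrableOn_compact hcpt) (hintegrable w)]
    refine setIntegral_congr_fun hcpt.isClosed.measurableSet fun x hx => ?_
    simp only [hdiv x hx]
  have hmass : |cross (N - A) (E - A)| / 2 * c = -α := by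
    rw [hflux]
    simpa using htest 1 0
  have hlin := htest 0 (A - N)
  have hr1 : ∫ t in (0 : ℝ)..1, (0 + t * ⟪N - E, A - N⟫) * ⟪φ (E + t • (N - E)), n⟫ =
      ⟪A - N, τ⟫ * (‖N - E‖ * ∫ t in (0 : ℝ)..1, t * ⟪φ (E + t • (N - E)), n⟫) := by
    rw [← mul_assoc, ← intervalIntegral.integral_const_mul]
    congr 1
    ext t
    nth_rewrite 1 [← hℓτ]
    rw [real_inner_smul_left, real_inner_comm]
    ring
  have hwn : ⟪A - N, n⟫ = ⟪n, A - E⟫ := by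
    rw [real_inner_comm, ← sub_sub_sub_cancel_right A N E, inner_sub_right, hn2, sub_zero]
  have hSn : ⟪N - S, n⟫ = -⟪n, S - E⟫ := by
    rw [real_inner_comm, ← sub_sub_sub_cancel_right N S E, inner_sub_right, hn2, zero_sub]
  have hJ : ∫ x in convexHull ℝ {N, E, A}, ⟪A - x, φ x⟫ =
      ∫ x in convexHull ℝ {N, E, A}, ⟪φ x, A - N⟫ := by
    rw [← sub_zero (∫ x in convexHull ℝ {N, E, A}, ⟪φ x, A - N⟫), ← horth, ← integral_sub (hintegrable _)
      ((hφc.inner (by fun_prop)).integrableOn_compact hcpt)]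
    congr 1
    ext x
    rw [← inner_sub_right, sub_sub_sub_cancel_right, real_inner_comm]
  have hval : ∫ x in convexHull ℝ {N, E, A}, ⟪φ x, A - N⟫ =
      α * (⟪GM - E, n⟫ * ⟪n, A - E⟫) := by
    have hsplit := inner_eq_add_of_orthonormal hτ1 hn1 hnτ (GM - E) (A - N)
    rw [hwn] at hsplit
    rw [hr1] at hlin
    linear_combination hlin - ⟪GM - E, A - N⟫ * hmass + ⟪A - N, τ⟫ * hmoment
      - ⟪A - N, τ⟫ * hdual + α * hsplit
  rw [hJ, hval, volume_triangle hDM0, volume_triangle hDL0, hDM, hDL, abs_neg, abs_mul, abs_mul, hr,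
    abs_of_pos hn3, abs_of_neg hS, hSn]
  have h3 := hn3.ne'
  have h4 := hS.ne
  field_simp
end

section
/- Let S, N, W, B, C ∈ ℝ² with S ≠ N. Let K = (S + N + W)/3, P = (W + N + B)/3, Q = (S + W + C)/3 and let ρ_K = √((1/36)·(‖S−N‖² + ‖N−W‖² + ‖W−S‖²)). For real numbers η, β, γ define η̃₂ = (ρ_K² + ‖K − N‖²)·η − (1/6)·⟨B − S, (B − N) + (W − N) + (S − N)⟩·β − (1/6)·⟨C − N, (W − N) + (C − N) + (S − N)⟩·γ and η₂ = (ρ_K² + ‖K − S‖²)·η − (1/6)·⟨B − S, (N − S) + (B − S) + (W − S)⟩·β − (1/6)·⟨C − N, (N − S) + (W − S) + (C − S)⟩·γ. Then (η₂ − η̃₂ + ‖N − S‖²·η)/(2·‖N − S‖) = (1/‖N − S‖)·⟨(K − S)·η − (P − K)·β − (Q − K)·γ, N − S⟩. (Proposition 5, second expression (3.23) for the first order momentum η₁.) -/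
open scoped RealInnerProductSpace

/-- Proposition 5, second expression (3.23) for the first order momentum `η₁`. -/
theorem stmt9 (S N W B C : EuclideanSpace ℝ (Fin 2)) (hSN : S ≠ N)
    (K P Q : EuclideanSpace ℝ (Fin 2))
    (hK : K = (1 / 3 : ℝ) • (S + N + W))
    (hP : P = (1 / 3 : ℝ) • (W + N + B))
    (hQ : Q = (1 / 3 : ℝ) • (S + W + C))
    (ρK : ℝ)
    (hρK : ρK = Real.sqrt ((1 / 36) * (‖S - N‖ ^ 2 + ‖N - W‖ ^ 2 + ‖W - S‖ ^ 2)))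
    (η β γ η₂ η₂' : ℝ)
    (hη₂' : η₂' = (ρK ^ 2 + ‖K - N‖ ^ 2) * η
      - (1 / 6) * ⟪B - S, (B - N) + (W - N) + (S - N)⟫ * β
      - (1 / 6) * ⟪C - N, (W - N) + (C - N) + (S - N)⟫ * γ)
    (hη₂ : η₂ = (ρK ^ 2 + ‖K - S‖ ^ 2) * η
      - (1 / 6) * ⟪B - S, (N - S) + (B - S) + (W - S)⟫ * β
      - (1 / 6) * ⟪C - N, (N - S) + (W - S) + (C - S)⟫ * γ) :
    (η₂ - η₂' + ‖N - S‖ ^ 2 * η) / (2 * ‖N - S‖) =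
      (1 / ‖N - S‖) * ⟪η • (K - S) - β • (P - K) - γ • (Q - K), N - S⟫ := by
  have hd : ‖N - S‖ ≠ 0 := norm_ne_zero_iff.mpr (sub_ne_zero.mpr hSN.symm)
  have hKS : ‖K - N‖ ^ 2 = ‖K - S‖ ^ 2 - 2 * ⟪K - S, N - S⟫ + ‖N - S‖ ^ 2 := by
    rw [← norm_sub_sq_real, sub_sub_sub_cancel_right]
  have hB : (N - S) + (B - S) + (W - S) =
      ((B - N) + (W - N) + (S - N)) + (4 : ℝ) • (N - S) := by module
  have hC : (N - S) + (W - S) + (C - S) =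
      ((W - N) + (C - N) + (S - N)) + (4 : ℝ) • (N - S) := by module
  have hPK : P - K = (1 / 3 : ℝ) • (B - S) := by rw [hP, hK]; module
  have hQK : Q - K = (1 / 3 : ℝ) • (C - N) := by rw [hQ, hK]; module
  rw [hη₂, hη₂', hKS, hB, hC, hPK, hQK]
  simp only [inner_sub_left (𝕜 := ℝ) (_ • _), inner_sub_left (𝕜 := ℝ) (_ - _) (_ • _),
    inner_add_right _ _ ((4 : ℝ) • _), real_inner_smul_left, real_inner_smul_right]
  field_simp
  ring
end

section
/- Let S, N, E ∈ ℝ² be affinely independent, L = conv{S, E, N} with area |L| and centroid G_L = (S + E + N)/3, and let A, D ∈ ℝ². Set M = (N + E + A)/3, R = (E + S + D)/3, with radii of gyration ρ_L, ρ_M, ρ_R of (S,E,N), (N,E,A), (E,S,D). Let n_SN be the unit vector orthogonal to N − S with ⟨n_SN, E − S⟩ > 0, n_EN the unit vector orthogonal to N − E with ⟨n_EN, S − E⟩ < 0, and n_SE the unit vector orthogonal to E − S with ⟨n_SE, N − S⟩ < 0. Let φ be a C¹ vector field on a neighborhood of L whose divergence is constant on L. Define, with arclength parametrizations: η = ∫₀^{‖SN‖}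 ⟨φ(S + s·(N−S)/‖SN‖), n_SN⟩ ds, η₁ and η₂ the corresponding first and second moments (factors s and s²); α = ∫₀^{‖EN‖} ⟨φ(E + s·(N−E)/‖EN‖), n_EN⟩ ds and α₂ its second moment (factor s²); δ = ∫₀^{‖SE‖} ⟨φ(S + s·(E−S)/‖SE‖), n_SE⟩ ds and δ̃₂ its reversed second moment (factor (‖SE‖ − s)²). Assume: α₂ = (ρ_M² + ‖M − E‖²)·α; δ̃₂ = (ρ_R² + ‖R − E‖²)·δ; η₂ = (ρ_L² + ‖G_L − S‖²)·η + (1/6)·⟨A − S, (E−S)+(A−S)+(N−S)⟩·α + (1/6)·⟨D − N, (D−S)+(E−S)+(N−S)⟩·δ; and η₁ = (1/‖SN‖)·⟨(G_L − S)·η + (M − G_L)·α + (R − G_L)·δ, N − S⟩. Then (1/(2|L|))·∫_L ⟨φ(x), E − x⟩ dx = (1/‖SN‖)·⟨(G_L − S)·η + (M − G_L)·α + (R − G_L)·δ, n_SN⟩. (Lemma 4, first identity (3.24).) -/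
open MeasureTheory
open scoped RealInnerProductSpace

local notation "Plane" => EuclideanSpace ℝ (Fin 2)

/-- The closed triangle in `ℝ × ℝ` with vertices `(0, 0)`, `(1, 0)`, `(0, 1)`. -/
def unitTriangle : Set (ℝ × ℝ) := {z | 0 ≤ z.1 ∧ 0 ≤ z.2 ∧ z.1 + z.2 ≤ 1}

lemma isCompact_unitTriangle : IsCompact unitTriangle := by
  have hc : IsClosed unitTriangle :=
    (isClosed_le continuous_const continuous_fst).inter
      ((isClosed_le continuous_const continuous_snd).inter
        (isClosed_le (continuous_fst.add continuous_snd) continuous_const))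
  refine (isCompact_Icc (a := ((0, 0) : ℝ × ℝ)) (b := (1, 1))).of_isClosed_subset hc ?_
  rintro ⟨u, v⟩ ⟨h1, h2, h3⟩
  simp only at h1 h2 h3
  exact ⟨⟨h1, h2⟩, ⟨by simp only; linarith, by simp only; linarith⟩⟩

lemma setIntegral_unitTriangle {F : ℝ × ℝ → ℝ} (hF : ContinuousOn F unitTriangle) :
    ∫ z in unitTriangle, F z = ∫ v in (0 : ℝ)..1, ∫ u in (0 : ℝ)..(1 - v), F (u, v) := by
  have hm := isCompact_unitTriangle.measurableSet
  have hint : Integrable (unitTriangle.indicator F) (volume.prod volume) :=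
    (integrable_indicator_iff hm).2 (hF.integrableOn_compact isCompact_unitTriangle)
  rw [← integral_indicator hm, Measure.volume_eq_prod, integral_prod_symm _ hint,
    intervalIntegral.integral_of_le zero_le_one, ← integral_Icc_eq_integral_Ioc,
    ← integral_indicator measurableSet_Icc]
  congr 1 with v
  by_cases hv : v ∈ Set.Icc (0 : ℝ) 1
  · rw [Set.indicator_of_mem hv, intervalIntegral.integral_of_le (by linarith [hv.2]),
      ← integral_Icc_eq_integral_Ioc, ← integral_indicator measurableSet_Icc]
    congr 1 with u
    have hiff : (u, v) ∈ unitTriangle ↔ u ∈ Set.Icc 0 (1 - v) :=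
      ⟨fun h => ⟨h.1, by linarith [h.2.2]⟩, fun h => ⟨h.1, hv.1, by simp only; linarith [h.2]⟩⟩
    simp only [Set.indicator, hiff]
  · rw [Set.indicator_of_notMem hv]
    refine integral_eq_zero_of_ae (.of_forall fun u => Set.indicator_of_notMem (fun h => hv ?_) _)
    exact ⟨h.2.1, by linarith [h.1, h.2.2]⟩

lemma setIntegral_unitTriangle_swap (F : ℝ × ℝ → ℝ) :
    ∫ z in unitTriangle, F z.swap = ∫ z in unitTriangle, F z := by
  have h := (Measure.measurePreserving_swap (μ := (volume : Measure ℝ))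
    (ν := (volume : Measure ℝ))).setIntegral_preimage_emb
      MeasurableEquiv.prodComm.measurableEmbedding F unitTriangle
  rw [← Measure.volume_eq_prod] at h
  rw [← h]
  congr 2
  ext z
  simp [unitTriangle, add_comm]
  tauto

lemma setIntegral_unitTriangle_deriv_fst {p p' : ℝ × ℝ → ℝ} (hp' : ContinuousOn p' unitTriangle)
    (hp : ∀ z ∈ unitTriangle, HasDerivAt (fun u => p (u, z.2)) (p' z) z.1) :
    ∫ z in unitTriangle, p' z = ∫ v in (0 : ℝ)..1, (p (1 - v, v) - p (0, v)) := by
  rw [setIntegral_unitTriangle hp']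
  refine intervalIntegral.integral_congr fun v hv => ?_
  rw [Set.uIcc_of_le zero_le_one] at hv
  have hmem : ∀ u ∈ Set.uIcc 0 (1 - v), (u, v) ∈ unitTriangle := fun u hu => by
    rw [Set.uIcc_of_le (by linarith [hv.2])] at hu
    exact ⟨hu.1, hv.1, by simp only; linarith [hu.2]⟩
  refine intervalIntegral.integral_eq_sub_of_hasDerivAt (f := fun u => p (u, v))
    (fun u hu => hp (u, v) (hmem u hu)) ?_
  exact (hp'.comp (by fun_prop) hmem).intervalIntegrable

lemma setIntegral_unitTriangle_deriv_snd {p p' : ℝ × ℝ → ℝ} (hp' : ContinuousOn p' unitTriangle)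
    (hp : ∀ z ∈ unitTriangle, HasDerivAt (fun v => p (z.1, v)) (p' z) z.2) :
    ∫ z in unitTriangle, p' z = ∫ v in (0 : ℝ)..1, (p (1 - v, v) - p (1 - v, 0)) := by
  have hswap : ∀ z ∈ unitTriangle, z.swap ∈ unitTriangle :=
    fun z hz => ⟨hz.2.1, hz.1, by simpa [add_comm] using hz.2.2⟩
  rw [← setIntegral_unitTriangle_swap,
    setIntegral_unitTriangle_deriv_fst (p := fun z => p z.swap) (p' := fun z => p' z.swap)
      (hp'.comp continuous_swap.continuousOn hswap) fun z hz => hp z.swap (hswap z hz)]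
  have h := intervalIntegral.integral_comp_sub_left
    (fun v => p (v, 1 - v) - p (v, 0)) (a := (0 : ℝ)) (b := 1) 1
  simp only [sub_self, sub_zero, sub_sub_cancel] at h
  exact h.symm

/-- The map `x ↦ x₀ b₁ - x₁ b₀`. -/
noncomputable def crossWith (b : Plane) : Plane →L[ℝ] ℝ :=
  b 1 • EuclideanSpace.proj 0 - b 0 • EuclideanSpace.proj 1

lemma crossWith_apply (b x : Plane) : crossWith b x = x 0 * b 1 - x 1 * b 0 := by
  simp [crossWith, mul_comm]

lemma inner_eq_coord (x y : Plane) : ⟪x, y⟫ = x 0 * y 0 + x 1 * y 1 := by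
  simp [PiLp.inner_apply, Fin.sum_univ_two, mul_comm]

lemma norm_sq_eq_coord (x : Plane) : ‖x‖ ^ 2 = x 0 ^ 2 + x 1 ^ 2 := by
  rw [← real_inner_self_eq_norm_sq, inner_eq_coord]; ring

lemma exists_eq_mul_rotation_of_inner_eq_zero {n t : Plane} (hn : ‖n‖ = 1) (hnt : ⟪n, t⟫ = 0) :
    ∃ d : ℝ, t 0 = -d * n 1 ∧ t 1 = d * n 0 := by
  have h1 : n 0 ^ 2 + n 1 ^ 2 = 1 := by rw [← norm_sq_eq_coord, hn]; norm_num
  rw [inner_eq_coord] at hnt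
  exact ⟨n 0 * t 1 - n 1 * t 0, by linear_combination (-t 0) * h1 + n 0 * hnt,
    by linear_combination (-t 1) * h1 + n 1 * hnt⟩

/-- A unit normal to `t` on the side of `e`, scaled by `‖t‖`, is a rotation of `t`. -/
lemma norm_mul_inner_unit_normal {n t e : Plane} (hn : ‖n‖ = 1) (hnt : ⟪n, t⟫ = 0)
    (hne : 0 < ⟪n, e⟫) (x : Plane) :
    ‖t‖ * ⟪n, x⟫ = SignType.sign (crossWith t e) * crossWith t x := by
  have h1 : n 0 ^ 2 + n 1 ^ 2 = 1 := by rw [← norm_sq_eq_coord, hn]; norm_num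
  have ht := norm_sq_eq_coord t
  obtain ⟨d, h0, h2⟩ := exists_eq_mul_rotation_of_inner_eq_zero hn hnt
  rw [inner_eq_coord] at hne ⊢
  rw [crossWith_apply, crossWith_apply]
  have hd2 : ‖t‖ = |d| := by
    rw [← abs_of_nonneg (norm_nonneg t), ← sq_eq_sq_iff_abs_eq_abs, ht, h0, h2]
    linear_combination d ^ 2 * h1
  have key : ∀ y : Plane, y 0 * t 1 - y 1 * t 0 = d * (n 0 * y 0 + n 1 * y 1) := fun y => by
    rw [h0, h2]; ring
  rw [hd2, key, key, sign_mul, sign_pos hne, mul_one, ← mul_assoc, sign_mul_self]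

lemma crossWith_mul_trace (f : Plane →ₗ[ℝ] Plane) (a b : Plane) :
    crossWith b a * LinearMap.trace ℝ Plane f = crossWith b (f a) - crossWith a (f b) := by
  have htr : LinearMap.trace ℝ Plane f
      = f (EuclideanSpace.single 0 1) 0 + f (EuclideanSpace.single 1 1) 1 := by
    rw [LinearMap.trace_eq_sum_inner f (EuclideanSpace.basisFun (Fin 2) ℝ), Fin.sum_univ_two]
    simp [inner_eq_coord]
  have hf : ∀ x : Plane, f x = x 0 • f (EuclideanSpace.single 0 1)
      + x 1 • f (EuclideanSpace.single 1 1) := fun x => by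
    rw [← map_smul, ← map_smul, ← map_add]
    congr 1
    ext i
    fin_cases i <;> simp
  rw [htr, crossWith_apply, crossWith_apply, crossWith_apply, hf a, hf b]
  simp only [PiLp.add_apply, PiLp.smul_apply, smul_eq_mul]
  ring

lemma convexHull_triple_eq_image (S E N : Plane) :
    convexHull ℝ {S, E, N} =
      (fun z : ℝ × ℝ => S + z.1 • (E - S) + z.2 • (N - S)) '' unitTriangle := by
  apply Set.Subset.antisymm
  · refine convexHull_min ?_ ?_
    · rintro x (rfl | rfl | rfl)
      · exact ⟨(0, 0), ⟨le_rfl, le_rfl, by norm_num⟩, by simp⟩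
      · exact ⟨(1, 0), ⟨zero_le_one, le_rfl, by norm_num⟩, by simp⟩
      · exact ⟨(0, 1), ⟨le_rfl, zero_le_one, by norm_num⟩, by simp⟩
    · rintro _ ⟨z, ⟨h1, h2, h3⟩, rfl⟩ _ ⟨w, ⟨k1, k2, k3⟩, rfl⟩ r s hr hs hrs
      refine ⟨r • z + s • w, ⟨?_, ?_, ?_⟩, ?_⟩
      · simp only [Prod.fst_add, Prod.smul_fst, smul_eq_mul]; positivity
      · simp only [Prod.snd_add, Prod.smul_snd, smul_eq_mul]; positivity
      · simp only [Prod.fst_add, Prod.smul_fst, Prod.snd_add, Prod.smul_snd, smul_eq_mul]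
        nlinarith [mul_le_mul_of_nonneg_left h3 hr, mul_le_mul_of_nonneg_left k3 hs]
      · obtain rfl : s = 1 - r := by linarith
        simp only [Prod.fst_add, Prod.smul_fst, Prod.snd_add, Prod.smul_snd, smul_eq_mul]
        module
  · rintro _ ⟨z, ⟨h1, h2, h3⟩, rfl⟩
    have hc := convex_convexHull ℝ ({S, E, N} : Set Plane)
    have hmem : ∀ i : Fin 3, ![S, E, N] i ∈ convexHull ℝ ({S, E, N} : Set Plane) := fun i =>
      subset_convexHull ℝ _ (by fin_cases i <;> simp)
    have h := hc.sum_mem (t := Finset.univ) (w := ![1 - z.1 - z.2, z.1, z.2])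
      (fun i _ => by fin_cases i <;> simp <;> linarith) (by simp [Fin.sum_univ_three]; ring)
      (fun i _ => hmem i)
    convert h using 1
    simp only [Fin.sum_univ_three, Matrix.cons_val]
    module

lemma setIntegral_convexHull_triple (S E N : Plane) (h : crossWith (N - S) (E - S) ≠ 0)
    (g : Plane → ℝ) :
    ∫ x in convexHull ℝ {S, E, N}, g x = |crossWith (N - S) (E - S)| *
      ∫ z in unitTriangle, g (S + z.1 • (E - S) + z.2 • (N - S)) := by
  set a := E - S
  set b := N - S
  rw [crossWith_apply] at h ⊢
  let Φ : ℝ × ℝ ≃ᵐ Plane :=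
    MeasurableEquiv.finTwoArrow.symm.trans (MeasurableEquiv.toLp 2 (Fin 2 → ℝ))
  have hΦ : MeasurePreserving Φ volume volume :=
    (volume_preserving_finTwoArrow ℝ).symm.trans (PiLp.volume_preserving_toLp (Fin 2))
  have hΦ0 : ∀ z, Φ z 0 = z.1 := fun z => rfl
  have hΦ1 : ∀ z, Φ z 1 = z.2 := fun z => rfl
  let A : ℝ × ℝ →L[ℝ] ℝ × ℝ := LinearMap.toContinuousLinearMap
    (Matrix.toLin (.finTwoProd ℝ) (.finTwoProd ℝ) !![a 0, b 0; a 1, b 1])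
  have hA : ∀ z, A z = (a 0 * z.1 + b 0 * z.2, a 1 * z.1 + b 1 * z.2) := fun z =>
    Matrix.toLin_finTwoProd_apply _ _ _ _ z
  have hdet : A.det = a 0 * b 1 - a 1 * b 0 := by
    simp only [A, ContinuousLinearMap.det, LinearMap.coe_toContinuousLinearMap, LinearMap.det_toLin,
      Matrix.det_fin_two_of]
    ring
  have hf : ∀ z, Φ ((S 0, S 1) + A z) = S + z.1 • a + z.2 • b := fun z => by
    ext i
    fin_cases i
    · simp [hΦ0, hA]; ring
    · simp [hΦ1, hA]; ring
  have hinj : Function.Injective fun z => (S 0, S 1) + A z := by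
    intro z w hzw
    have h0 : A z = A w := add_left_cancel hzw
    rw [hA, hA, Prod.mk.injEq] at h0
    obtain ⟨h1, h2⟩ := h0
    refine Prod.ext (mul_left_cancel₀ h ?_) (mul_left_cancel₀ h ?_)
    · linear_combination b 1 * h1 - b 0 * h2
    · linear_combination a 0 * h2 - a 1 * h1
  have hpre : Φ ⁻¹' convexHull ℝ {S, E, N} = (fun z => (S 0, S 1) + A z) '' unitTriangle := by
    rw [convexHull_triple_eq_image]
    apply Φ.injective.image_injective
    rw [Set.image_preimage_eq _ Φ.surjective, Set.image_image]
    simp_rw [hf]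
    rfl
  rw [← hΦ.setIntegral_preimage_emb Φ.measurableEmbedding, hpre,
    integral_image_eq_integral_abs_det_fderiv_smul volume isCompact_unitTriangle.measurableSet
      (fun z _ => (A.hasFDerivAt.const_add _).hasFDerivWithinAt) hinj.injOn]
  simp_rw [hf, hdet, smul_eq_mul]
  rw [integral_const_mul]

/-- The flux of `ψ` across the segment from `X` to `Y` in the direction `n`. -/
noncomputable def flux (X Y n : Plane) (ψ : Plane → Plane) : ℝ :=
  ∫ s in (0 : ℝ)..‖Y - X‖, ⟪ψ (X + s • (‖Y - X‖⁻¹ • (Y - X))), n⟫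

lemma flux_eq_cross {X Y n e : Plane} (hXY : Y ≠ X) (hn : ‖n‖ = 1) (hn0 : ⟪n, Y - X⟫ = 0)
    (hne : 0 < ⟪n, e⟫) (ψ : Plane → Plane) :
    flux X Y n ψ = SignType.sign (crossWith (Y - X) e) *
      ∫ s in (0 : ℝ)..1, crossWith (Y - X) (ψ (X + s • (Y - X))) := by
  have h0 : ‖Y - X‖ ≠ 0 := norm_ne_zero_iff.2 (sub_ne_zero.2 hXY)
  have h := intervalIntegral.mul_integral_comp_mul_left (a := 0) (b := 1)
    (f := fun s => ⟪ψ (X + s • (‖Y - X‖⁻¹ • (Y - X))), n⟫) (c := ‖Y - X‖)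
  rw [mul_zero, mul_one] at h
  rw [flux, ← h, ← intervalIntegral.integral_const_mul, ← intervalIntegral.integral_const_mul]
  congr 1 with s
  rw [← norm_mul_inner_unit_normal hn hn0 hne, real_inner_comm, smul_smul, mul_right_comm,
    mul_inv_cancel₀ h0, one_mul]

lemma trace_fderiv_norm_sq_smul {φ : Plane → Plane} {x : Plane} (hφ : DifferentiableAt ℝ φ x)
    (E : Plane) :
    LinearMap.trace ℝ Plane (fderiv ℝ (fun y => ‖y - E‖ ^ 2 • φ y) x).toLinearMap =
      ‖x - E‖ ^ 2 * LinearMap.trace ℝ Plane (fderiv ℝ φ x).toLinearMap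
        + 2 * ⟪x - E, φ x⟫ := by
  have h1 : HasFDerivAt (fun y => ‖y - E‖ ^ 2) (2 • innerSL ℝ (x - E)) x := by
    simpa using ((hasFDerivAt_id x).sub_const E).norm_sq
  have h2 : HasFDerivAt (fun y => ‖y - E‖ ^ 2 • φ y) _ x := h1.smul hφ.hasFDerivAt
  rw [h2.fderiv]
  simp only [LinearMap.trace_eq_sum_inner _ (EuclideanSpace.basisFun (Fin 2) ℝ),
    Fin.sum_univ_two, inner_eq_coord]
  simp [inner_eq_coord]
  ring

section Divergence

variable {S N E : Plane} {U : Set Plane} {ψ : Plane → Plane}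

/-- The divergence theorem on a triangle, in terms of cross products. -/
lemma setIntegral_trace_fderiv_eq_cross (h : crossWith (N - S) (E - S) ≠ 0) (hU : IsOpen U)
    (hLU : convexHull ℝ {S, E, N} ⊆ U) (hψ : ContDiffOn ℝ 1 ψ U) :
    ∫ x in convexHull ℝ {S, E, N}, LinearMap.trace ℝ Plane (fderiv ℝ ψ x).toLinearMap =
      SignType.sign (crossWith (N - S) (E - S)) *
        ((∫ s in (0 : ℝ)..1, crossWith (N - E) (ψ (E + s • (N - E))))
          + (∫ s in (0 : ℝ)..1, crossWith (E - S) (ψ (S + s • (E - S))))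
          - ∫ s in (0 : ℝ)..1, crossWith (N - S) (ψ (S + s • (N - S)))) := by
  rw [setIntegral_convexHull_triple S E N h]
  set a := E - S with ha
  set b := N - S with hb
  have hab : N - E = b - a := by rw [ha, hb]; abel
  set T : ℝ × ℝ → Plane := fun z => S + z.1 • a + z.2 • b with hT
  have hTc : Continuous T := by fun_prop
  have hTU : Set.MapsTo T unitTriangle U := fun z hz =>
    hLU (convexHull_triple_eq_image S E N ▸ Set.mem_image_of_mem _ hz)
  have hdψ : ∀ z ∈ unitTriangle, HasFDerivAt ψ (fderiv ℝ ψ (T z)) (T z) := fun z hz =>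
    ((hψ.differentiableOn one_ne_zero).differentiableAt (hU.mem_nhds (hTU hz))).hasFDerivAt
  have hDc : ContinuousOn (fun z => fderiv ℝ ψ (T z)) unitTriangle :=
    (hψ.continuousOn_fderiv_of_isOpen hU le_rfl).comp hTc.continuousOn hTU
  have hψc : ContinuousOn (fun z => ψ (T z)) unitTriangle :=
    hψ.continuousOn.comp hTc.continuousOn hTU
  have hpc : ContinuousOn (fun z => crossWith b (fderiv ℝ ψ (T z) a)) unitTriangle :=
    (crossWith b).continuous.comp_continuousOn (hDc.clm_apply continuousOn_const)
  have hqc : ContinuousOn (fun z => crossWith a (fderiv ℝ ψ (T z) b)) unitTriangle :=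
    (crossWith a).continuous.comp_continuousOn (hDc.clm_apply continuousOn_const)
  have hp := setIntegral_unitTriangle_deriv_fst (p := fun z => crossWith b (ψ (T z))) hpc
    fun z hz => by
      have h1 : HasDerivAt (fun u : ℝ => S + u • a + z.2 • b) a z.1 := by
        simpa using (((hasDerivAt_id z.1).smul_const a).const_add S).add_const (z.2 • b)
      exact (crossWith b).hasFDerivAt.comp_hasDerivAt _ ((hdψ z hz).comp_hasDerivAt _ h1)
  have hq := setIntegral_unitTriangle_deriv_snd (p := fun z => crossWith a (ψ (T z))) hqc
    fun z hz => by
      have h1 : HasDerivAt (fun v : ℝ => S + z.1 • a + v • b) b z.2 := by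
        simpa using ((hasDerivAt_id z.2).smul_const b).const_add (S + z.1 • a)
      exact (crossWith a).hasFDerivAt.comp_hasDerivAt _ ((hdψ z hz).comp_hasDerivAt _ h1)
  have hi : ∀ (e : Plane) (γ : ℝ → ℝ × ℝ), Continuous γ →
      (∀ v ∈ Set.Icc (0 : ℝ) 1, γ v ∈ unitTriangle) →
      IntervalIntegrable (fun v => crossWith e (ψ (T (γ v)))) volume 0 1 := fun e γ hγ hm => by
    refine ContinuousOn.intervalIntegrable ?_
    rw [Set.uIcc_of_le zero_le_one]
    exact (crossWith e).continuous.comp_continuousOn (hψc.comp hγ.continuousOn hm)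
  have hi1 := fun e => hi e (fun v => (1 - v, v)) (by fun_prop)
    fun v hv => ⟨by simp only; linarith [hv.2], hv.1, by simp⟩
  have hi2 := hi b (fun v => (0, v)) (by fun_prop) fun v hv => ⟨le_rfl, hv.1, by simpa using hv.2⟩
  have hi3 := hi a (fun v => (1 - v, 0)) (by fun_prop)
    fun v hv => ⟨by simp only; linarith [hv.2], le_rfl, by simpa using hv.1⟩
  rw [intervalIntegral.integral_sub (hi1 b) hi2] at hp
  rw [intervalIntegral.integral_sub (hi1 a) hi3,
    intervalIntegral.integral_comp_sub_left (fun v => crossWith a (ψ (T (v, 0)))) 1,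
    sub_self, sub_zero] at hq
  have hhyp : ∫ s in (0 : ℝ)..1, crossWith (N - E) (ψ (E + s • (N - E))) =
      (∫ s in (0 : ℝ)..1, crossWith b (ψ (T (1 - s, s))))
        - ∫ s in (0 : ℝ)..1, crossWith a (ψ (T (1 - s, s))) := by
    rw [← intervalIntegral.integral_sub (hi1 b) (hi1 a)]
    congr 1 with s
    have : E + s • (N - E) = T (1 - s, s) := by simp only [hT, ha, hb]; module
    rw [this, hab]
    simp only [crossWith_apply, PiLp.sub_apply]
    ring
  rw [← sign_mul_self, mul_assoc, ← integral_const_mul]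
  simp_rw [crossWith_mul_trace]
  simp only [ContinuousLinearMap.coe_coe]
  rw [integral_sub (hpc.integrableOn_compact isCompact_unitTriangle)
    (hqc.integrableOn_compact isCompact_unitTriangle), hp, hq, hhyp]
  simp only [hT, zero_smul, add_zero]
  ring

/-- The divergence theorem on a triangle; the normal to `SN` points into the triangle and the
normals to the other two edges point out of it. -/
theorem setIntegral_trace_fderiv_eq_flux {nSN nEN nSE : Plane}
    (h : crossWith (N - S) (E - S) ≠ 0)
    (hnSN : ‖nSN‖ = 1) (hnSN0 : ⟪nSN, N - S⟫ = 0) (hnSNE : 0 < ⟪nSN, E - S⟫)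
    (hnEN : ‖nEN‖ = 1) (hnEN0 : ⟪nEN, N - E⟫ = 0) (hnENS : ⟪nEN, S - E⟫ < 0)
    (hnSE : ‖nSE‖ = 1) (hnSE0 : ⟪nSE, E - S⟫ = 0) (hnSEN : ⟪nSE, N - S⟫ < 0)
    (hU : IsOpen U) (hLU : convexHull ℝ {S, E, N} ⊆ U) (hψ : ContDiffOn ℝ 1 ψ U) :
    ∫ x in convexHull ℝ {S, E, N}, LinearMap.trace ℝ Plane (fderiv ℝ ψ x).toLinearMap =
      flux E N nEN ψ + flux S E nSE ψ - flux S N nSN ψ := by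
  have hNS : N ≠ S := by rintro rfl; simp [crossWith_apply] at h
  have hES : E ≠ S := by rintro rfl; simp [crossWith_apply] at h
  have hNE : N ≠ E := by rintro rfl; simp [crossWith_apply, mul_comm] at h
  have h1 : 0 < ⟪nEN, E - S⟫ := by rw [← neg_sub, inner_neg_right]; linarith
  have h2 : 0 < ⟪nSE, S - N⟫ := by rw [← neg_sub, inner_neg_right]; linarith
  have c1 : crossWith (N - E) (E - S) = crossWith (N - S) (E - S) := by
    simp only [crossWith_apply, PiLp.sub_apply]; ring
  have c2 : crossWith (E - S) (S - N) = crossWith (N - S) (E - S) := by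
    simp only [crossWith_apply, PiLp.sub_apply]; ring
  rw [setIntegral_trace_fderiv_eq_cross h hU hLU hψ, flux_eq_cross hNS hnSN hnSN0 hnSNE,
    flux_eq_cross hNE hnEN hnEN0 h1, flux_eq_cross hES hnSE hnSE0 h2, c1, c2]
  ring

lemma isCompact_convexHull_triple (S E N : Plane) :
    IsCompact (convexHull ℝ ({S, E, N} : Set Plane)) :=
  Set.Finite.isCompact_convexHull ℝ (Set.toFinite _)

/-- The divergence theorem for `x ↦ ‖x - E‖² φ(x)`, when `φ` has constant divergence. -/
theorem setIntegral_inner_eq_flux {φ : Plane → Plane} {nSN nEN nSE : Plane} {c : ℝ}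
    (h : crossWith (N - S) (E - S) ≠ 0)
    (hnSN : ‖nSN‖ = 1) (hnSN0 : ⟪nSN, N - S⟫ = 0) (hnSNE : 0 < ⟪nSN, E - S⟫)
    (hnEN : ‖nEN‖ = 1) (hnEN0 : ⟪nEN, N - E⟫ = 0) (hnENS : ⟪nEN, S - E⟫ < 0)
    (hnSE : ‖nSE‖ = 1) (hnSE0 : ⟪nSE, E - S⟫ = 0) (hnSEN : ⟪nSE, N - S⟫ < 0)
    (hU : IsOpen U) (hLU : convexHull ℝ {S, E, N} ⊆ U) (hφ : ContDiffOn ℝ 1 φ U)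
    (hdiv : ∀ x ∈ convexHull ℝ ({S, E, N} : Set Plane),
      LinearMap.trace ℝ Plane (fderiv ℝ φ x).toLinearMap = c) :
    c * (∫ x in convexHull ℝ {S, E, N}, ‖x - E‖ ^ 2)
        + 2 * ∫ x in convexHull ℝ {S, E, N}, ⟪x - E, φ x⟫ =
      flux E N nEN (fun y => ‖y - E‖ ^ 2 • φ y) + flux S E nSE (fun y => ‖y - E‖ ^ 2 • φ y)
        - flux S N nSN (fun y => ‖y - E‖ ^ 2 • φ y) := by
  have hK := isCompact_convexHull_triple S E N
  have hsq : ContDiff ℝ 1 fun y : Plane => ‖y - E‖ ^ 2 :=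
    (contDiff_id.sub contDiff_const).norm_sq ℝ
  have hψ : ContDiffOn ℝ 1 (fun y => ‖y - E‖ ^ 2 • φ y) U := hsq.contDiffOn.smul hφ
  rw [← setIntegral_trace_fderiv_eq_flux h hnSN hnSN0 hnSNE hnEN hnEN0 hnENS hnSE hnSE0 hnSEN hU
    hLU hψ, ← integral_const_mul, ← integral_const_mul, ← integral_add]
  · refine setIntegral_congr_fun hK.measurableSet fun x hx => ?_
    have hd := (hφ.differentiableOn one_ne_zero).differentiableAt (hU.mem_nhds (hLU hx))
    rw [trace_fderiv_norm_sq_smul hd, hdiv x hx, mul_comm c]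
  · exact (Continuous.continuousOn (by fun_prop)).integrableOn_compact hK
  · exact (continuousOn_const.mul ((Continuous.continuousOn (by fun_prop)).inner
      (hφ.continuousOn.mono hLU))).integrableOn_compact hK

end Divergence

lemma norm_inv_norm_smul {X Y : Plane} (hXY : Y ≠ X) : ‖‖Y - X‖⁻¹ • (Y - X)‖ = 1 :=
  norm_smul_inv_norm (𝕜 := ℝ) (sub_ne_zero.2 hXY)

lemma flux_norm_sq_smul (X Y n C : Plane) (φ : Plane → Plane) :
    flux X Y n (fun y => ‖y - C‖ ^ 2 • φ y) = ∫ s in (0 : ℝ)..‖Y - X‖,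
      ‖X - C + s • (‖Y - X‖⁻¹ • (Y - X))‖ ^ 2 * ⟪φ (X + s • (‖Y - X‖⁻¹ • (Y - X))), n⟫ := by
  simp only [flux, real_inner_smul_left, add_sub_right_comm]

lemma flux_norm_sq_smul_start {X Y : Plane} (hXY : Y ≠ X) (n : Plane) (φ : Plane → Plane) :
    flux X Y n (fun y => ‖y - X‖ ^ 2 • φ y) = ∫ s in (0 : ℝ)..‖Y - X‖,
      s ^ 2 * ⟪φ (X + s • (‖Y - X‖⁻¹ • (Y - X))), n⟫ := by
  rw [flux_norm_sq_smul]
  congr 1 with s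
  rw [sub_self, zero_add, norm_smul, norm_inv_norm_smul hXY, mul_one, Real.norm_eq_abs, sq_abs]

lemma flux_norm_sq_smul_end {X Y : Plane} (hXY : Y ≠ X) (n : Plane) (φ : Plane → Plane) :
    flux X Y n (fun y => ‖y - Y‖ ^ 2 • φ y) = ∫ s in (0 : ℝ)..‖Y - X‖,
      (‖Y - X‖ - s) ^ 2 * ⟪φ (X + s • (‖Y - X‖⁻¹ • (Y - X))), n⟫ := by
  have h0 : ‖Y - X‖ ≠ 0 := norm_ne_zero_iff.2 (sub_ne_zero.2 hXY)
  rw [flux_norm_sq_smul]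
  congr 1 with s
  have : X - Y + s • (‖Y - X‖⁻¹ • (Y - X)) = (s - ‖Y - X‖) • (‖Y - X‖⁻¹ • (Y - X)) := by
    rw [sub_smul, smul_inv_smul₀ h0]; abel
  rw [this, norm_smul, norm_inv_norm_smul hXY, mul_one, Real.norm_eq_abs, sq_abs, sub_sq_comm]

/-- The flux of `‖y - C‖² φ(y)` in terms of the moments of the flux of `φ`. -/
lemma flux_norm_sq_smul_eq_moments {X Y : Plane} (hXY : Y ≠ X) (n C : Plane) {φ : Plane → Plane}
    (hφ : ContinuousOn φ (segment ℝ X Y)) :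
    flux X Y n (fun y => ‖y - C‖ ^ 2 • φ y) =
      ‖X - C‖ ^ 2 * flux X Y n φ
      + 2 * (‖Y - X‖⁻¹ * ⟪X - C, Y - X⟫) * (∫ s in (0 : ℝ)..‖Y - X‖,
        s * ⟪φ (X + s • (‖Y - X‖⁻¹ • (Y - X))), n⟫)
      + ∫ s in (0 : ℝ)..‖Y - X‖, s ^ 2 * ⟪φ (X + s • (‖Y - X‖⁻¹ • (Y - X))), n⟫ := by
  have h0 : 0 < ‖Y - X‖ := norm_pos_iff.2 (sub_ne_zero.2 hXY)
  have hc : ContinuousOn (fun s : ℝ => ⟪φ (X + s • (‖Y - X‖⁻¹ • (Y - X))), n⟫)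
      (Set.uIcc 0 ‖Y - X‖) := by
    refine ContinuousOn.inner (hφ.comp (by fun_prop) fun s hs => ?_) continuousOn_const
    rw [Set.uIcc_of_le h0.le] at hs
    rw [segment_eq_image']
    exact ⟨s * ‖Y - X‖⁻¹, ⟨mul_nonneg hs.1 (inv_nonneg.2 h0.le), by
      rw [← div_eq_mul_inv]; exact div_le_one_of_le₀ hs.2 h0.le⟩, by simp only [smul_smul]⟩
  rw [flux_norm_sq_smul, flux, ← intervalIntegral.integral_const_mul,
    ← intervalIntegral.integral_const_mul, ← intervalIntegral.integral_add,
    ← intervalIntegral.integral_add]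
  · congr 1 with s
    rw [norm_add_sq_real, norm_smul, norm_inv_norm_smul hXY, real_inner_smul_right,
      real_inner_smul_right, mul_one, Real.norm_eq_abs, sq_abs]
    ring
  · exact ((continuousOn_const.mul hc).add
      (continuousOn_const.mul (continuousOn_id.mul hc))).intervalIntegrable
  · exact ((continuousOn_id.pow 2).mul hc).intervalIntegrable
  · exact (continuousOn_const.mul hc).intervalIntegrable
  · exact (continuousOn_const.mul (continuousOn_id.mul hc)).intervalIntegrable

/-- On the segment `XY`, the field `y ↦ y - C` has constant normal component. -/
lemma inner_sub_eq_of_mem_line {X Y n : Plane} (hn : ⟪n, Y - X⟫ = 0) (C : Plane) (s : ℝ) :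
    ⟪X + s • (‖Y - X‖⁻¹ • (Y - X)) - C, n⟫ = ⟪n, X - C⟫ := by
  rw [add_sub_right_comm, real_inner_comm, inner_add_right, real_inner_smul_right,
    real_inner_smul_right, hn]
  ring

lemma flux_sub_const {X Y n : Plane} (hn : ⟪n, Y - X⟫ = 0) (C : Plane) :
    flux X Y n (fun y => y - C) = ‖Y - X‖ * ⟪n, X - C⟫ := by
  simp [flux, inner_sub_eq_of_mem_line hn]

lemma trace_fderiv_sub_const (E x : Plane) :
    LinearMap.trace ℝ Plane (fderiv ℝ (fun y => y - E) x).toLinearMap = 2 := by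
  rw [fderiv_sub_const, fderiv_fun_id]
  simp

section Moments

variable {S N E : Plane} {nSN nEN nSE : Plane}

lemma two_mul_volume_convexHull_triple
    (h : crossWith (N - S) (E - S) ≠ 0)
    (hnSN : ‖nSN‖ = 1) (hnSN0 : ⟪nSN, N - S⟫ = 0) (hnSNE : 0 < ⟪nSN, E - S⟫)
    (hnEN : ‖nEN‖ = 1) (hnEN0 : ⟪nEN, N - E⟫ = 0) (hnENS : ⟪nEN, S - E⟫ < 0)
    (hnSE : ‖nSE‖ = 1) (hnSE0 : ⟪nSE, E - S⟫ = 0) (hnSEN : ⟪nSE, N - S⟫ < 0) :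
    2 * volume.real (convexHull ℝ {S, E, N}) = ‖N - S‖ * ⟪nSN, E - S⟫ := by
  have hd := setIntegral_trace_fderiv_eq_flux h hnSN hnSN0 hnSNE hnEN hnEN0 hnENS hnSE hnSE0 hnSEN
    isOpen_univ (Set.subset_univ _) (contDiff_id.sub (contDiff_const (c := E))).contDiffOn
  simp only [id, trace_fderiv_sub_const, setIntegral_const, smul_eq_mul] at hd
  have e : S - E = -(E - S) := by abel
  rw [flux_sub_const hnSN0, flux_sub_const hnEN0, flux_sub_const hnSE0, sub_self, inner_zero_right,
    e, inner_neg_right, inner_neg_right, hnSE0] at hd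
  linarith

lemma four_mul_setIntegral_norm_sub_sq
    (h : crossWith (N - S) (E - S) ≠ 0)
    (hnSN : ‖nSN‖ = 1) (hnSN0 : ⟪nSN, N - S⟫ = 0) (hnSNE : 0 < ⟪nSN, E - S⟫)
    (hnEN : ‖nEN‖ = 1) (hnEN0 : ⟪nEN, N - E⟫ = 0) (hnENS : ⟪nEN, S - E⟫ < 0)
    (hnSE : ‖nSE‖ = 1) (hnSE0 : ⟪nSE, E - S⟫ = 0) (hnSEN : ⟪nSE, N - S⟫ < 0) :
    4 * ∫ x in convexHull ℝ {S, E, N}, ‖x - E‖ ^ 2 =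
      ‖N - S‖ * ⟪nSN, E - S⟫ * (‖S - E‖ ^ 2 + ⟪S - E, N - S⟫ + ‖N - S‖ ^ 2 / 3) := by
  have hNS : N ≠ S := by rintro rfl; simp [crossWith_apply] at h
  have hES : E ≠ S := by rintro rfl; simp [crossWith_apply] at h
  have hNE : N ≠ E := by rintro rfl; simp [crossWith_apply, mul_comm] at h
  have h0 : ‖N - S‖ ≠ 0 := norm_ne_zero_iff.2 (sub_ne_zero.2 hNS)
  have hd := setIntegral_inner_eq_flux (φ := fun y => y - E) h hnSN hnSN0 hnSNE hnEN hnEN0 hnENS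
    hnSE hnSE0 hnSEN isOpen_univ (Set.subset_univ _)
    (contDiff_id.sub (contDiff_const (c := E))).contDiffOn fun x _ => trace_fderiv_sub_const E x
  have e : S - E = -(E - S) := by abel
  rw [flux_norm_sq_smul_start hNE, flux_norm_sq_smul_end hES,
    flux_norm_sq_smul_eq_moments hNS _ _ (by fun_prop), flux_sub_const hnSN0] at hd
  simp only [inner_sub_eq_of_mem_line hnSN0, inner_sub_eq_of_mem_line hnEN0,
    inner_sub_eq_of_mem_line hnSE0, real_inner_self_eq_norm_sq,
    intervalIntegral.integral_mul_const, integral_id, integral_pow, sub_self, inner_zero_right] at hd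
  have e1 : ⟪nSN, S - E⟫ = -⟪nSN, E - S⟫ := by rw [e, inner_neg_right]
  have e2 : ⟪nSE, S - E⟫ = 0 := by rw [e, inner_neg_right, hnSE0, neg_zero]
  rw [e1, e2] at hd
  have e3 : ‖N - S‖⁻¹ * ‖N - S‖ = 1 := inv_mul_cancel₀ h0
  norm_num at hd
  linear_combination hd + ‖N - S‖ * ⟪nSN, E - S⟫ * ⟪S - E, N - S⟫ * e3

end Moments

lemma crossWith_ne_zero_of_affineIndependent {S N E : Plane}
    (hindep : AffineIndependent ℝ ![S, E, N]) : crossWith (N - S) (E - S) ≠ 0 := by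
  intro h
  rw [affineIndependent_iff] at hindep
  have key : ∀ x y : ℝ, x • (E - S) + y • (N - S) = 0 → x = 0 ∧ y = 0 := fun x y hxy => by
    have hw := hindep Finset.univ ![-(x + y), x, y] (by simp [Fin.sum_univ_three]) (by
      simp only [Fin.sum_univ_three, Matrix.cons_val]
      rw [← hxy]
      module)
    exact ⟨by simpa using hw 1 (Finset.mem_univ _), by simpa using hw 2 (Finset.mem_univ _)⟩
  rw [crossWith_apply] at h
  have h1 := key ((N - S) 1) (-(E - S) 1) (by
    ext i
    fin_cases i <;> simp at h ⊢ <;> linarith)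
  have h0 := key ((N - S) 0) (-(E - S) 0) (by
    ext i
    fin_cases i <;> simp at h ⊢ <;> linarith)
  have hN : N - S = 0 := by
    ext i
    fin_cases i
    · exact h0.1
    · exact h1.1
  exact one_ne_zero (key 0 1 (by simp [hN])).2

lemma inner_mul_norm_sq_of_unit_normal {n t : Plane} (hn : ‖n‖ = 1) (hnt : ⟪n, t⟫ = 0)
    (x y : Plane) :
    ⟪x, y⟫ * ‖t‖ ^ 2 = ‖t‖ ^ 2 * (⟪x, n⟫ * ⟪y, n⟫) + ⟪x, t⟫ * ⟪y, t⟫ := by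
  have h1 : n 0 ^ 2 + n 1 ^ 2 = 1 := by rw [← norm_sq_eq_coord, hn]; norm_num
  rw [norm_sq_eq_coord]
  obtain ⟨d, h0, h2⟩ := exists_eq_mul_rotation_of_inner_eq_zero hn hnt
  simp only [inner_eq_coord]
  rw [h0, h2]
  linear_combination -(d ^ 2 * (x 0 * n 0 + x 1 * n 1) * (y 0 * n 0 + y 1 * n 1)) * h1

/-- Lemma 4, first identity (3.24):
`(1/(2|L|)) ∫_L ⟨φ(x), E − x⟩ dx
   = (1/‖SN‖) ⟨η (G_L − S) + α (M − G_L) + δ (R − G_L), n_SN⟩`. -/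
theorem stmt11 (S N E : EuclideanSpace ℝ (Fin 2))
    (hindep : AffineIndependent ℝ ![S, E, N])
    (A D : EuclideanSpace ℝ (Fin 2))
    (G_L M R : EuclideanSpace ℝ (Fin 2))
    (hGL : G_L = (1 / 3 : ℝ) • (S + E + N))
    (hM : M = (1 / 3 : ℝ) • (N + E + A))
    (hR : R = (1 / 3 : ℝ) • (E + S + D))
    (ρL ρM ρR : ℝ)
    (hρL : ρL = Real.sqrt ((1 / 36) * (‖S - E‖ ^ 2 + ‖E - N‖ ^ 2 + ‖N - S‖ ^ 2)))
    (hρM : ρM = Real.sqrt ((1 / 36) * (‖N - E‖ ^ 2 + ‖E - A‖ ^ 2 + ‖A - N‖ ^ 2)))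
    (hρR : ρR = Real.sqrt ((1 / 36) * (‖E - S‖ ^ 2 + ‖S - D‖ ^ 2 + ‖D - E‖ ^ 2)))
    (nSN nEN nSE : EuclideanSpace ℝ (Fin 2))
    (hnSN : ‖nSN‖ = 1) (hnSN0 : ⟪nSN, N - S⟫ = 0) (hnSNE : 0 < ⟪nSN, E - S⟫)
    (hnEN : ‖nEN‖ = 1) (hnEN0 : ⟪nEN, N - E⟫ = 0) (hnENS : ⟪nEN, S - E⟫ < 0)
    (hnSE : ‖nSE‖ = 1) (hnSE0 : ⟪nSE, E - S⟫ = 0) (hnSEN : ⟪nSE, N - S⟫ < 0)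
    (φ : EuclideanSpace ℝ (Fin 2) → EuclideanSpace ℝ (Fin 2))
    (U : Set (EuclideanSpace ℝ (Fin 2))) (hU : IsOpen U)
    (hLU : convexHull ℝ {S, E, N} ⊆ U)
    (hφ : ContDiffOn ℝ 1 φ U)
    (c : ℝ)
    (hdiv : ∀ x ∈ convexHull ℝ ({S, E, N} : Set (EuclideanSpace ℝ (Fin 2))),
      LinearMap.trace ℝ (EuclideanSpace ℝ (Fin 2)) (fderiv ℝ φ x).toLinearMap = c)
    (η η₁ η₂ α α₂ δ δ₂' : ℝ)
    (hη : η = ∫ s in (0 : ℝ)..‖N - S‖, ⟪φ (S + s • ((‖N - S‖)⁻¹ • (N - S))), nSN⟫)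
    (hη₁ : η₁ = ∫ s in (0 : ℝ)..‖N - S‖,
      s * ⟪φ (S + s • ((‖N - S‖)⁻¹ • (N - S))), nSN⟫)
    (hη₂ : η₂ = ∫ s in (0 : ℝ)..‖N - S‖,
      s ^ 2 * ⟪φ (S + s • ((‖N - S‖)⁻¹ • (N - S))), nSN⟫)
    (hα : α = ∫ s in (0 : ℝ)..‖N - E‖, ⟪φ (E + s • ((‖N - E‖)⁻¹ • (N - E))), nEN⟫)
    (hα₂ : α₂ = ∫ s in (0 : ℝ)..‖N - E‖,
      s ^ 2 * ⟪φ (E + s • ((‖N - E‖)⁻¹ • (N - E))), nEN⟫)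
    (hδ : δ = ∫ s in (0 : ℝ)..‖E - S‖, ⟪φ (S + s • ((‖E - S‖)⁻¹ • (E - S))), nSE⟫)
    (hδ₂' : δ₂' = ∫ s in (0 : ℝ)..‖E - S‖,
      (‖E - S‖ - s) ^ 2 * ⟪φ (S + s • ((‖E - S‖)⁻¹ • (E - S))), nSE⟫)
    (hrelα : α₂ = (ρM ^ 2 + ‖M - E‖ ^ 2) * α)
    (hrelδ : δ₂' = (ρR ^ 2 + ‖R - E‖ ^ 2) * δ)
    (hrelη₂ : η₂ = (ρL ^ 2 + ‖G_L - S‖ ^ 2) * η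
      + (1 / 6) * ⟪A - S, (E - S) + (A - S) + (N - S)⟫ * α
      + (1 / 6) * ⟪D - N, (D - S) + (E - S) + (N - S)⟫ * δ)
    (hrelη₁ : η₁ = (1 / ‖N - S‖) *
      ⟪η • (G_L - S) + α • (M - G_L) + δ • (R - G_L), N - S⟫) :
    (1 / (2 * (volume (convexHull ℝ ({S, E, N} : Set (EuclideanSpace ℝ (Fin 2))))).toReal)) *
        ∫ x in convexHull ℝ ({S, E, N} : Set (EuclideanSpace ℝ (Fin 2))), ⟪φ x, E - x⟫ =
      (1 / ‖N - S‖) * ⟪η • (G_L - S) + α • (M - G_L) + δ • (R - G_L), nSN⟫ := by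
  have h := crossWith_ne_zero_of_affineIndependent hindep
  have hNS : N ≠ S := by rintro rfl; simp [crossWith_apply] at h
  have hES : E ≠ S := by rintro rfl; simp [crossWith_apply] at h
  have hNE : N ≠ E := by rintro rfl; simp [crossWith_apply, mul_comm] at h
  have hl : 0 < ‖N - S‖ := norm_pos_iff.2 (sub_ne_zero.2 hNS)
  have hseg : segment ℝ S N ⊆ U := (segment_subset_convexHull (by simp) (by simp)).trans hLU
  have hvol := two_mul_volume_convexHull_triple h hnSN hnSN0 hnSNE hnEN hnEN0 hnENS hnSE hnSE0 hnSEN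
  have hQ := four_mul_setIntegral_norm_sub_sq h hnSN hnSN0 hnSNE hnEN hnEN0 hnENS hnSE hnSE0 hnSEN
  have hF := setIntegral_trace_fderiv_eq_flux h hnSN hnSN0 hnSNE hnEN hnEN0 hnENS hnSE hnSE0 hnSEN
    hU hLU hφ
  have hI := setIntegral_inner_eq_flux h hnSN hnSN0 hnSNE hnEN hnEN0 hnENS hnSE hnSE0 hnSEN hU hLU
    hφ hdiv
  rw [setIntegral_congr_fun (isCompact_convexHull_triple S E N).measurableSet hdiv,
    setIntegral_const, smul_eq_mul, show flux E N nEN φ = α from hα.symm,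
    show flux S E nSE φ = δ from hδ.symm, show flux S N nSN φ = η from hη.symm] at hF
  rw [flux_norm_sq_smul_start hNE, flux_norm_sq_smul_end hES,
    flux_norm_sq_smul_eq_moments hNS _ _ (hφ.continuousOn.mono hseg),
    show flux S N nSN φ = η from hη.symm, ← hη₁, ← hη₂, ← hα₂, ← hδ₂'] at hI
  have hswap : ∫ x in convexHull ℝ {S, E, N}, ⟪φ x, E - x⟫ =
      -∫ x in convexHull ℝ {S, E, N}, ⟪x - E, φ x⟫ := by
    rw [← integral_neg]
    congr 1 with x
    rw [real_inner_comm, ← inner_neg_left, neg_sub]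
  change 1 / (2 * volume.real _) * _ = _
  rw [hswap, hvol]
  have hmom : (c * ∫ x in convexHull ℝ {S, E, N}, ‖x - E‖ ^ 2) =
      (α + δ - η) * ((‖S - E‖ ^ 2 + ⟪S - E, N - S⟫ + ‖N - S‖ ^ 2 / 3) / 2) := by
    linear_combination (c / 4) * hQ + (‖S - E‖ ^ 2 + ⟪S - E, N - S⟫ + ‖N - S‖ ^ 2 / 3) / 2 * hF
      - (c / 4) * (‖S - E‖ ^ 2 + ⟪S - E, N - S⟫ + ‖N - S‖ ^ 2 / 3) * hvol
  have hkey : 2 * ⟪η • (G_L - S) + α • (M - G_L) + δ • (R - G_L), E - S⟫ =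
      (α + δ - η) * ((‖S - E‖ ^ 2 + ⟪S - E, N - S⟫ + ‖N - S‖ ^ 2 / 3) / 2) - α₂ - δ₂'
        + ‖S - E‖ ^ 2 * η + η₂ := by
    rw [hrelα, hrelδ, hrelη₂, hρL, hρM, hρR, Real.sq_sqrt (by positivity),
      Real.sq_sqrt (by positivity), Real.sq_sqrt (by positivity), hGL, hM, hR]
    simp only [norm_sq_eq_coord, inner_eq_coord, PiLp.add_apply, PiLp.sub_apply, PiLp.smul_apply,
      smul_eq_mul]
    ring
  generalize η • (G_L - S) + α • (M - G_L) + δ • (R - G_L) = v at *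
  have hdec := inner_mul_norm_sq_of_unit_normal hnSN hnSN0 v (E - S)
  have hneg : ⟪S - E, N - S⟫ = -⟪E - S, N - S⟫ := by rw [← inner_neg_left, neg_sub]
  rw [real_inner_comm nSN (E - S)] at hdec
  have hdec' : ⟪v, E - S⟫ = ⟪v, nSN⟫ * ⟪nSN, E - S⟫
      + ‖N - S‖⁻¹ ^ 2 * (⟪v, N - S⟫ * ⟪E - S, N - S⟫) := by
    field_simp
    linear_combination hdec
  rw [one_div] at hrelη₁
  have hJ : -∫ x in convexHull ℝ {S, E, N}, ⟪x - E, φ x⟫ = ⟪v, nSN⟫ * ⟪nSN, E - S⟫ := by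
    rw [hmom, hneg, hrelη₁] at hI
    rw [hneg] at hkey
    linear_combination hdec' - hI / 2 - hkey / 2
  rw [hJ]
  field_simp
end
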